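/- Let κ be a kernel on S, μ a probability vector on S with μ_r > 0 for all r, and c ∈ [0,∞)^S with c ≤ μ componentwise and Σ(κ,c) ≤ 1. Then inf{ I_Mi(λ) : λ : ℕ₀^S → [0,∞), λ_0 = 0, c(λ) = c } = ∑_{r∈S} c_r log(c_r/μ_r) + (1/2) ∑_{r,s∈S} c_r κ(r,s)(μ_s − c_s) (conventions log 0 = −∞, 0·log 0 = 0), and the infimum is attained at λ(c) and at no other admissible λ. -/

import Mathlib

open scoped Classical ENNReal
open Filter MeasureTheory

noncomputable section

/-- The set of ordered pairs `(i,j)` of vertices with `i < j`, representing the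
potential edges of a graph on `Fin n`. -/
def upperPairs (n : ℕ) : Finset (Fin n × Fin n) :=
  Finset.univ.filter fun q => q.1 < q.2

/-- The simple graph on `Fin n` determined by a finite set of (ordered) edges. -/
def graphOf {n : ℕ} (E : Finset (Fin n × Fin n)) : SimpleGraph (Fin n) :=
  SimpleGraph.fromRel fun i j => (i, j) ∈ E

/-- `PConn n x p` is the probability that the inhomogeneous random graph `G(n, x, p)`,
with type vector `x` and independent edges where `{i,j}` is present with probability
`p (x i) (x j)`, is connected; written as a finite sum over connected graphs. -/
def PConn {S : Type*} (n : ℕ) (x : Fin n → S) (p : S → S → ℝ) : ℝ :=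
  ∑ E ∈ (upperPairs n).powerset.filter (fun E => (graphOf E).Connected),
    (∏ q ∈ E, p (x q.1) (x q.2)) * ∏ q ∈ upperPairs n \ E, (1 - p (x q.1) (x q.2))

/-- Sum over all spanning trees (connected graphs with `n - 1` edges) on `Fin n` of the
product of the kernel over the edges. -/
def treeWeight {S : Type*} (n : ℕ) (x : Fin n → S) (κ : S → S → ℝ) : ℝ :=
  ∑ E ∈ (upperPairs n).powerset.filter
      (fun E => (graphOf E).Connected ∧ E.card + 1 = n),
    ∏ q ∈ E, κ (x q.1) (x q.2)

/-- A canonical list of types compatible with the multiplicity vector `k`. -/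
def compatList {S : Type*} [Fintype S] (k : S → ℕ) : List S :=
  (∑ s : S, (k s) • ({s} : Multiset S)).toList

lemma compatList_length {S : Type*} [Fintype S] (k : S → ℕ) :
    (compatList k).length = ∑ s : S, k s := by
  simp [compatList]

/-- A canonical type vector compatible with `k`, i.e. with `∑ i δ_{x i} = k`. -/
def compatVec {S : Type*} [Fintype S] (k : S → ℕ) : Fin (∑ s : S, k s) → S :=
  fun i => (compatList k).get (Fin.cast (compatList_length k).symm i)

/-- `tau κ k` is the spanning-tree weight `τ(k; κ)`. -/
def tau {S : Type*} [Fintype S] (κ : S → S → ℝ) (k : S → ℕ) : ℝ :=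
  treeWeight (∑ s : S, k s) (compatVec k) κ

/-- `pN κN N k` is the probability that the inhomogeneous random graph on a vertex set
with type composition `k` and edge probabilities `min 1 (κN/N)` is connected. -/
def pN {S : Type*} [Fintype S] (κN : S → S → ℝ) (N : ℕ) (k : S → ℕ) : ℝ :=
  PConn (∑ s : S, k s) (compatVec k) fun r s => min 1 (κN r s / N)

/-- Extended-real logarithm, with `elog x = -∞` for `x ≤ 0`. -/
def elog (x : ℝ) : EReal := if x ≤ 0 then (⊥ : EReal) else ((Real.log x : ℝ) : EReal)

/-- The nonnegative part of `-log u`, equal to `∞` if `u ≤ 0`. -/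
def negLogPart (u : ℝ) : ℝ≥0∞ := if u ≤ 0 then ⊤ else ENNReal.ofReal (-Real.log u)

/-- The relative-entropy summand `x log (x / d)` with conventions `0 log 0 = 0` and
`x log (x/0) = +∞` for `x ≠ 0`. -/
def entTerm (x d : ℝ) : EReal :=
  if x = 0 then (0 : EReal) else if d ≤ 0 then (⊤ : EReal)
  else ((x * Real.log (x / d) : ℝ) : EReal)

/-- `‖κ‖_∞ = max_{r,s} κ r s`. -/
def kernelSup {S : Type*} [Fintype S] [Nonempty S] (κ : S → S → ℝ) : ℝ :=
  Finset.univ.sup' Finset.univ_nonempty fun r =>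
    Finset.univ.sup' Finset.univ_nonempty fun s => κ r s

/-- `Σ(κ, ν)`, the `ℓ²(ν)`-operator norm of the matrix `(κ r s * ν s)_{r,s}`. -/
def sigmaOp {S : Type*} [Fintype S] (κ : S → S → ℝ) (ν : S → ℝ) : ℝ :=
  sSup { t : ℝ | ∃ f : S → ℝ, (∀ s, 0 ≤ f s) ∧ (∑ r : S, ν r * f r ^ 2) ≤ 1 ∧
    t = Real.sqrt (∑ r : S, ν r * (∑ s : S, κ r s * f s * ν s) ^ 2) }

/-- Irreducibility of the kernel `κ` with respect to `ν`. -/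
def Irred {S : Type*} (κ : S → S → ℝ) (ν : S → ℝ) : Prop :=
  ∀ A : Set S, (∀ r ∈ A, ∀ s, s ∉ A → 0 < ν r → 0 < ν s → κ r s = 0) →
    (∀ r ∈ A, ν r = 0) ∨ (∀ s, s ∉ A → ν s = 0)

/-- The generating series `Γ_r(θ) = ∑_k τ(k) k_r ∏_s θ_s^{k_s}/k_s! ∈ [0,∞]`. -/
def Gamma0 {S : Type*} [Fintype S] (κ : S → S → ℝ) (θ : S → ℝ) (r : S) : ℝ≥0∞ :=
  ∑' k : S → ℕ,
    ENNReal.ofReal (tau κ k * (k r : ℝ) * ∏ s : S, θ s ^ (k s) / (Nat.factorial (k s) : ℝ))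

/-- `χ(κ, θ)`: the infimum over probability vectors `w ≪ θ` of
`∑_r w_r log (w_r / ((κ w)_r θ_r))`. -/
def chiFn {S : Type*} [Fintype S] (κ : S → S → ℝ) (θ : S → ℝ) : EReal :=
  sInf { v : EReal | ∃ w : S → ℝ, (∀ r, 0 ≤ w r) ∧ ((∑ r : S, w r) = 1) ∧
    (∀ r, θ r = 0 → w r = 0) ∧
    v = ∑ r : S, entTerm (w r) ((∑ s : S, κ r s * w s) * θ r) }

/-- `Δ_r(k)`: the sum over directed spanning trees of the support of `k` rooted at `r`
(encoded as parent maps `f`, edges `(f s, s)` directed away from the root) of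
`∏ κ(f s, s) * k (f s)`. -/
def Delta {S : Type*} [Fintype S] [DecidableEq S] (κ : S → S → ℝ) (k : S → ℕ) (r : S) : ℝ :=
  ∑ f ∈ (Finset.univ : Finset (S → S)).filter (fun f =>
      (∀ s, (s = r ∨ k s = 0) → f s = s) ∧
      ∀ s, 0 < k s → s ≠ r → (0 < k (f s) ∧ ∃ n, f^[n] s = r)),
    ∏ s ∈ Finset.univ.filter (fun s => 0 < k s ∧ s ≠ r), (κ (f s) s * (k (f s) : ℝ))

/-- The reference weight `τ(k) ∏_s μ_s^{k_s}/k_s!`. -/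
def rhoMu {S : Type*} [Fintype S] (κ : S → S → ℝ) (μ : S → ℝ) (k : S → ℕ) : ℝ :=
  tau κ k * ∏ s : S, μ s ^ (k s) / (Nat.factorial (k s) : ℝ)

/-- The microscopic rate function `I_Mi`. -/
def IMi {S : Type*} [Fintype S] (κ : S → S → ℝ) (μ : S → ℝ) (lam : (S → ℕ) → ℝ) : EReal :=
  (∑' k : S → ℕ, entTerm (lam k) (rhoMu κ μ k))
  + ((∑' k : S → ℕ, lam k * (((∑ s : S, k s : ℕ) : ℝ) - 1) : ℝ) : EReal)
  + ((((1 : ℝ)/2) * ∑ r : S, ∑ s : S, (∑' k : S → ℕ, lam k * (k r : ℝ)) * κ r s * μ s : ℝ) : EReal)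

/-- The minimizer candidate `λ_k(c) = τ(k) ∏_s (c_s e^{-(κ c)_s})^{k_s}/k_s!`. -/
def lamC {S : Type*} [Fintype S] (κ : S → S → ℝ) (c : S → ℝ) (k : S → ℕ) : ℝ :=
  tau κ k * ∏ s : S, (c s * Real.exp (-(∑ t : S, κ s t * c t))) ^ (k s) / (Nat.factorial (k s) : ℝ)

/-- The mesoscopic rate function `I_Me`. -/
def IMe {S : Type*} [Fintype S] (κ : S → S → ℝ) (μ ν : S → ℝ) : EReal :=
  (∑ r : S, entTerm (ν r) ((∑ s : S, κ r s * ν s) * μ r))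
  + ((((1 : ℝ)/2) * ∑ r : S, ∑ s : S, ν r * κ r s * μ s : ℝ) : EReal)

/-- `b` is a solution of the fixed-point system for `c`:
`b ∈ [0,∞)^S`, `b ≤ c` and `(κ(c-b))_r b_r = c_r - b_r` for all `r`. -/
def IsFPSol {S : Type*} [Fintype S] (κ : S → S → ℝ) (c b : S → ℝ) : Prop :=
  (∀ r, 0 ≤ b r) ∧ (∀ r, b r ≤ c r) ∧
    ∀ r, (∑ s : S, κ r s * (c s - b s)) * b r = c r - b r

/-- The macroscopic rate summand `f_Ma`. -/
def fMa {S : Type*} [Fintype S] (κ : S → S → ℝ) (μ y : S → ℝ) : EReal :=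
  (∑ r : S, entTerm (y r) ((1 - Real.exp (-(∑ s : S, κ r s * y s))) * μ r))
  + ((((1 : ℝ)/2) * ∑ r : S, ∑ s : S, y r * κ r s * (μ s - y s) : ℝ) : EReal)

/-- The functional `G_c(b)`. -/
def Gc {S : Type*} [Fintype S] (κ : S → S → ℝ) (μ c b : S → ℝ) : EReal :=
  (((∑ r : S, b r * Real.log (b r / μ r))
      - (1/2) * ∑ r : S, ∑ s : S, b r * κ r s * b s
      + (1/2) * ∑ r : S, ∑ s : S, c r * κ r s * μ s : ℝ) : EReal)
  + ∑ r : S, entTerm (c r - b r) ((∑ s : S, κ r s * (c s - b s)) * μ r)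

/-- `λ_k(t) = t^{|k|-1} τ(k) e^{-t⟨k,κμ⟩} ∏_r μ_r^{k_r}/k_r!`. -/
def lamT {S : Type*} [Fintype S] (κ : S → S → ℝ) (μ : S → ℝ) (k : S → ℕ) (t : ℝ) : ℝ :=
  t ^ ((∑ s : S, k s) - 1) * tau κ k *
    Real.exp (-t * ∑ r : S, ∑ s : S, (k r : ℝ) * κ r s * μ s) *
    ∏ r : S, μ r ^ (k r) / (Nat.factorial (k r) : ℝ)

/-! ### Part A: combinatorics of trees -/

def gE {V : Type*} (E : Finset (Sym2 V)) : SimpleGraph V :=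
  SimpleGraph.fromEdgeSet (E : Set (Sym2 V))

def TreeOn {V : Type*} (A : Finset V) (E : Finset (Sym2 V)) : Prop :=
  (∀ e ∈ E, ¬ e.IsDiag ∧ ∀ a ∈ e, a ∈ A) ∧
  (∀ x ∈ A, ∀ y ∈ A, (gE E).Reachable x y) ∧ E.card + 1 = A.card

lemma gE_adj {V : Type*} (E : Finset (Sym2 V)) (a b : V) :
    (gE E).Adj a b ↔ s(a, b) ∈ E ∧ a ≠ b := by
  simp [gE]

lemma gE_mono {V : Type*} {E F : Finset (Sym2 V)} (h : E ⊆ F) : gE E ≤ gE F := by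
  intro a b hab
  rw [gE_adj] at *
  exact ⟨h hab.1, hab.2⟩

lemma reach_closed {V : Type*} {G : SimpleGraph V} {P : V → Prop}
    (h : ∀ a b, G.Adj a b → P a → P b) {x y : V} (hr : G.Reachable x y) (hx : P x) : P y := by
  obtain ⟨w⟩ := hr
  induction w with
  | nil => exact hx
  | cons hadj _ ih => exact ih (h _ _ hadj hx)

lemma conn_card {V : Type*} [Fintype V] [DecidableEq V] (A : Finset V) (E : Finset (Sym2 V))
    (h1 : ∀ e ∈ E, ∀ a ∈ e, a ∈ A) (x : V) (hx : x ∈ A)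
    (h2 : ∀ y ∈ A, (gE E).Reachable x y) : A.card ≤ E.card + 1 := by
  let G : SimpleGraph A := (gE E).induce (A : Set V)
  have hreach : ∀ y : A, G.Reachable ⟨x, hx⟩ y := by
    intro y
    have := reach_closed (G := gE E) (P := fun z => ∃ hz : z ∈ A, G.Reachable ⟨x, hx⟩ ⟨z, hz⟩)
      (by
        rintro a b hab ⟨ha, hr⟩
        have hb : b ∈ A := h1 _ ((gE_adj _ _ _).1 hab).1 b (by simp)
        refine ⟨hb, hr.trans (SimpleGraph.Adj.reachable ?_)⟩
        exact hab) (h2 y y.2) ⟨hx, SimpleGraph.Reachable.refl _⟩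
    obtain ⟨_, h⟩ := this
    exact h
  have hc : G.Connected := by
    have : Nonempty A := ⟨⟨x, hx⟩⟩
    exact SimpleGraph.Connected.mk fun a b => (hreach a).symm.trans (hreach b)
  have := hc.card_vert_le_card_edgeSet_add_one
  have h3 : Nat.card G.edgeSet ≤ E.card := by
    have h0 : Nat.card E = E.card := by simp
    rw [← h0]
    refine Nat.card_le_card_of_injective
      (fun e : G.edgeSet => (⟨Sym2.map Subtype.val e.1, ?_⟩ : E)) ?_
    · obtain ⟨e, he⟩ := e
      induction e using Sym2.ind with
      | _ a b =>
        have : (gE E).Adj a b := he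
        simpa using ((gE_adj _ _ _).1 this).1
    · rintro ⟨e, he⟩ ⟨f, hf⟩ h
      simp only [Subtype.mk.injEq] at h
      exact Subtype.ext (Sym2.map.injective Subtype.val_injective h)
  have h4 : Nat.card A = A.card := by simp
  have h5 : Nat.card (A : Set V) = A.card := by simp
  omega

def compOf {V : Type*} [Fintype V] [DecidableEq V] (u v : V) (E : Finset (Sym2 V)) : Finset V :=
  Finset.univ.filter fun x => (gE (E.filter fun e => v ∉ e)).Reachable u x

def Good {V : Type*} [Fintype V] [DecidableEq V] (u v : V) (B : Finset V) (i : V)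
    (E₁ E₂ : Finset (Sym2 V)) : Prop :=
  u ∈ B ∧ v ∉ B ∧ i ∈ B ∧ TreeOn B E₁ ∧ TreeOn Bᶜ E₂

section
variable {V : Type*} [Fintype V] [DecidableEq V]

lemma good_cmp {u v : V} {B : Finset V} {i : V} {E₁ E₂ : Finset (Sym2 V)}
    (h : Good u v B i E₁ E₂) : compOf u v (insert s(v, i) (E₁ ∪ E₂)) = B := by
  obtain ⟨hu, hv, hi, h1, h2⟩ := h
  ext x
  simp only [compOf, Finset.mem_filter, Finset.mem_univ, true_and]
  constructor
  · intro hr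
    refine reach_closed (P := fun x => x ∈ B) ?_ hr hu
    intro a b hab ha
    rw [gE_adj] at hab
    obtain ⟨hab, hne⟩ := hab
    simp only [Finset.mem_filter, Finset.mem_insert, Finset.mem_union] at hab
    obtain ⟨h | h | h, hv'⟩ := hab
    · rw [h] at hv'; simp at hv'
    · exact (h1.1 _ h).2 b (by simp)
    · have := (h2.1 _ h).2 a (by simp)
      simp [ha] at this
  · intro hx
    refine (h1.2.1 u hu x hx).mono (gE_mono ?_)
    intro e he
    simp only [Finset.mem_filter, Finset.mem_insert, Finset.mem_union]
    exact ⟨Or.inr (Or.inl he), fun hve => hv ((h1.1 e he).2 v hve)⟩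

lemma good_not_mem {u v : V} {B : Finset V} {i : V} {E₁ E₂ : Finset (Sym2 V)}
    (h : Good u v B i E₁ E₂) : s(v, i) ∉ E₁ ∪ E₂ ∧ Disjoint E₁ E₂ := by
  obtain ⟨hu, hv, hi, h1, h2⟩ := h
  constructor
  · rw [Finset.mem_union]
    rintro (h | h)
    · exact hv ((h1.1 _ h).2 v (by simp))
    · have := (h2.1 _ h).2 i (by simp)
      simp [hi] at this
  · rw [Finset.disjoint_left]
    intro e he he'
    induction e using Sym2.ind with
    | _ a b =>
      have ha := (h1.1 _ he).2 a (by simp)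
      have ha' := (h2.1 _ he').2 a (by simp)
      simp [ha] at ha'

lemma good_tree {u v : V} {B : Finset V} {i : V} {E₁ E₂ : Finset (Sym2 V)}
    (h : Good u v B i E₁ E₂) : TreeOn Finset.univ (insert s(v, i) (E₁ ∪ E₂)) := by
  obtain ⟨hn, hd⟩ := good_not_mem h
  obtain ⟨hu, hv, hi, h1, h2⟩ := h
  have hvi : v ≠ i := fun h => hv (h ▸ hi)
  refine ⟨?_, ?_, ?_⟩
  · intro e he
    refine ⟨?_, fun a _ => Finset.mem_univ a⟩
    simp only [Finset.mem_insert, Finset.mem_union] at he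
    rcases he with rfl | h | h
    · simpa using hvi
    · exact (h1.1 e h).1
    · exact (h2.1 e h).1
  · have key : ∀ x, (gE (insert s(v, i) (E₁ ∪ E₂))).Reachable v x := by
      intro x
      by_cases hx : x ∈ B
      · have hadj : (gE (insert s(v, i) (E₁ ∪ E₂))).Adj v i := by
          rw [gE_adj]; exact ⟨by simp, hvi⟩
        refine hadj.reachable.trans ((h1.2.1 i hi x hx).mono (gE_mono ?_))
        intro e he; simp [he]
      · refine (h2.2.1 v (by simpa using hv) x (by simpa using hx)).mono (gE_mono ?_)
        intro e he; simp [he]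
    intro x _ y _
    exact (key x).symm.trans (key y)
  · rw [Finset.card_insert_of_notMem hn, Finset.card_union_of_disjoint hd]
    have := h1.2.2
    have := h2.2.2
    have := Finset.card_add_card_compl B
    rw [Finset.card_univ]
    omega

lemma good_filter {u v : V} {B : Finset V} {i : V} {E₁ E₂ : Finset (Sym2 V)}
    (h : Good u v B i E₁ E₂) :
    (insert s(v, i) (E₁ ∪ E₂)).filter (fun e => ∀ a ∈ e, a ∈ B) = E₁ ∧
    (insert s(v, i) (E₁ ∪ E₂)).filter (fun e => ∀ a ∈ e, a ∈ Bᶜ) = E₂ := by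
  obtain ⟨hu, hv, hi, h1, h2⟩ := h
  constructor
  · ext e
    simp only [Finset.mem_filter, Finset.mem_insert, Finset.mem_union]
    constructor
    · rintro ⟨rfl | h | h, h'⟩
      · exact absurd (h' v (by simp)) hv
      · exact h
      · exfalso
        induction e using Sym2.ind with
        | _ a b =>
          have ha := (h2.1 _ h).2 a (by simp)
          have ha' := h' a (by simp)
          simp [ha'] at ha
    · intro h
      exact ⟨Or.inr (Or.inl h), (h1.1 e h).2⟩
  · ext e
    simp only [Finset.mem_filter, Finset.mem_insert, Finset.mem_union]
    constructor
    · rintro ⟨rfl | h | h, h'⟩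
      · have := h' i (by simp)
        simp [hi] at this
      · exfalso
        induction e using Sym2.ind with
        | _ a b =>
          have ha := (h1.1 _ h).2 a (by simp)
          have ha' := h' a (by simp)
          simp [ha] at ha'
      · exact h
    · intro h
      exact ⟨Or.inr (Or.inr h), (h2.1 e h).2⟩

lemma tree_good {u v : V} (huv : u ≠ v) {E : Finset (Sym2 V)} (h : TreeOn Finset.univ E) :
    ∃ B i E₁ E₂, Good u v B i E₁ E₂ ∧ insert s(v, i) (E₁ ∪ E₂) = E := by
  set B := compOf u v E with hB
  have memB : ∀ x, x ∈ B ↔ (gE (E.filter fun e => v ∉ e)).Reachable u x := by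
    intro x; simp [hB, compOf]
  have hu : u ∈ B := (memB u).2 (SimpleGraph.Reachable.refl _)
  have hv : v ∉ B := by
    intro hv
    have := (memB v).1 hv
    refine reach_closed (P := fun x => x ≠ v) ?_ this huv rfl
    intro a b hab _ hbv
    rw [gE_adj] at hab
    have := hab.1
    simp [hbv] at this
  -- edges not at v stay in or out of B
  have closed : ∀ a b, s(a, b) ∈ E → a ≠ v → b ≠ v → a ∈ B → b ∈ B := by
    intro a b hab ha hb haB
    rw [memB] at *
    refine haB.trans (SimpleGraph.Adj.reachable ?_)
    rw [gE_adj]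
    refine ⟨?_, ?_⟩
    · simp [hab, ha.symm, hb.symm]
    · rintro rfl
      exact (h.1 _ hab).1 (by simp)
  set E₁ := E.filter (fun e => ∀ a ∈ e, a ∈ B) with hE1
  set E₂ := E.filter (fun e => ∀ a ∈ e, a ∈ Bᶜ) with hE2
  set C := E.filter (fun e => (¬ ∀ a ∈ e, a ∈ B) ∧ ¬ ∀ a ∈ e, a ∈ Bᶜ) with hC
  have hCe : ∀ e ∈ C, ∃ i ∈ B, e = s(v, i) := by
    intro e he
    rw [hC, Finset.mem_filter] at he
    obtain ⟨heE, h1, h2⟩ := he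
    induction e using Sym2.ind with
    | _ a b =>
      have heE' : s(b, a) ∈ E := by rw [Sym2.eq_swap]; exact heE
      simp only [Sym2.mem_iff, forall_eq_or_imp, forall_eq, Finset.mem_compl] at h1 h2
      by_cases ha : a ∈ B
      · have hb : b ∉ B := fun hb => h1 ⟨ha, hb⟩
        have hav : a ≠ v := fun h => hv (h ▸ ha)
        have hbv : b = v := by
          by_contra hbv
          exact hb (closed a b heE hav hbv ha)
        exact ⟨a, ha, by rw [hbv, Sym2.eq_swap]⟩
      · have hb : b ∈ B := by
          by_contra hb
          exact h2 ⟨ha, hb⟩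
        have hbv : b ≠ v := fun h => hv (h ▸ hb)
        have hav : a = v := by
          by_contra hav
          exact ha (closed b a heE' hbv hav hb)
        exact ⟨b, hb, by rw [hav]⟩
  have hunion : E = C ∪ (E₁ ∪ E₂) := by
    ext e
    simp only [hC, hE1, hE2, Finset.mem_union, Finset.mem_filter]
    tauto
  have hd2 : Disjoint E₁ E₂ := by
    rw [Finset.disjoint_left]
    intro e he he'
    rw [hE1, Finset.mem_filter] at he
    rw [hE2, Finset.mem_filter] at he'
    induction e using Sym2.ind with
    | _ a b =>
      have ha := he.2 a (by simp)
      have ha' := he'.2 a (by simp)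
      simp [ha] at ha'
  have hd1 : Disjoint C (E₁ ∪ E₂) := by
    rw [Finset.disjoint_left]
    intro e he he'
    simp only [hC, hE1, hE2, Finset.mem_union, Finset.mem_filter] at he he'
    tauto
  have hcard : E.card = C.card + (E₁.card + E₂.card) := by
    conv_lhs => rw [hunion]
    rw [Finset.card_union_of_disjoint hd1, Finset.card_union_of_disjoint hd2]
  have r1 : ∀ y ∈ B, (gE E₁).Reachable u y := by
    intro y hy
    have := reach_closed (P := fun y => y ∈ B ∧ (gE E₁).Reachable u y) ?_ ((memB y).1 hy)
      ⟨hu, SimpleGraph.Reachable.refl _⟩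
    · exact this.2
    · rintro a b hab ⟨ha, har⟩
      rw [gE_adj, Finset.mem_filter] at hab
      obtain ⟨⟨habE, hvab⟩, hne⟩ := hab
      simp only [Sym2.mem_iff, not_or] at hvab
      have hb : b ∈ B := closed a b habE (Ne.symm hvab.1) (Ne.symm hvab.2) ha
      refine ⟨hb, har.trans (SimpleGraph.Adj.reachable ?_)⟩
      rw [gE_adj]
      refine ⟨?_, hne⟩
      simp [hE1, habE, ha, hb]
  have r2 : ∀ y ∈ Bᶜ, (gE E₂).Reachable v y := by
    intro y hy
    have := reach_closed (P := fun y => y ∈ B ∨ (gE E₂).Reachable v y) ?_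
      (h.2.1 v (Finset.mem_univ _) y (Finset.mem_univ _)) (Or.inr (SimpleGraph.Reachable.refl _))
    · rcases this with h | h
      · simp [h] at hy
      · exact h
    · intro a b hab hP
      by_cases hb : b ∈ B
      · exact Or.inl hb
      right
      rw [gE_adj] at hab
      obtain ⟨habE, hne⟩ := hab
      by_cases ha : a ∈ B
      · have hav : a ≠ v := fun h => hv (h ▸ ha)
        have : b = v := by
          by_contra hbv
          exact hb (closed a b habE hav hbv ha)
        rw [this]
      · rcases hP with h | h
        · exact absurd h ha
        · refine h.trans (SimpleGraph.Adj.reachable ?_)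
          rw [gE_adj]
          refine ⟨?_, hne⟩
          simp [hE2, habE, ha, hb]
  have c1 := conn_card B E₁ (by
    intro e he; rw [hE1, Finset.mem_filter] at he; exact he.2) u hu r1
  have c2 := conn_card Bᶜ E₂ (by
    intro e he; rw [hE2, Finset.mem_filter] at he; exact he.2) v (by simpa using hv) r2
  have c3 : 1 ≤ C.card := by
    rw [Nat.one_le_iff_ne_zero, Ne, Finset.card_eq_zero]
    intro hC0
    refine hv (reach_closed (P := fun x => x ∈ B) ?_
      (h.2.1 u (Finset.mem_univ _) v (Finset.mem_univ _)) hu)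
    intro a b hab ha
    rw [gE_adj] at hab
    by_contra hb
    have : s(a, b) ∈ C := by
      simp [hC, hab.1, ha, hb]
    rw [hC0] at this
    simp at this
  have c4 := h.2.2
  have c5 := Finset.card_add_card_compl B
  rw [Finset.card_univ] at c4
  have c6 : C.card = 1 := by omega
  obtain ⟨e, he⟩ := Finset.card_eq_one.1 c6
  obtain ⟨i, hi, rfl⟩ := hCe e (by simp [he])
  refine ⟨B, i, E₁, E₂, ⟨hu, hv, hi, ⟨?_, ?_, by omega⟩, ⟨?_, ?_, by omega⟩⟩, ?_⟩
  · intro e he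
    rw [hE1, Finset.mem_filter] at he
    exact ⟨(h.1 e he.1).1, he.2⟩
  · intro x hx y hy
    exact (r1 x hx).symm.trans (r1 y hy)
  · intro e he
    rw [hE2, Finset.mem_filter] at he
    exact ⟨(h.1 e he.1).1, he.2⟩
  · intro x hx y hy
    exact (r2 x hx).symm.trans (r2 y hy)
  · rw [hunion, he]; rfl

def trees (A : Finset V) : Finset (Finset (Sym2 V)) := Finset.univ.filter (TreeOn A)

lemma sum_trees (u v : V) (huv : u ≠ v) (f : Finset (Sym2 V) → ℝ) :
    ∑ E ∈ trees Finset.univ, f E =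
      ∑ B ∈ Finset.univ.filter (fun B : Finset V => u ∈ B ∧ v ∉ B), ∑ i ∈ B,
        ∑ E₁ ∈ trees B, ∑ E₂ ∈ trees Bᶜ, f (insert s(v, i) (E₁ ∪ E₂)) := by
  have : ∑ p ∈ (Finset.univ : Finset (Finset V × V × Finset (Sym2 V) × Finset (Sym2 V))).filter
        (fun p => Good u v p.1 p.2.1 p.2.2.1 p.2.2.2),
        f (insert s(v, p.2.1) (p.2.2.1 ∪ p.2.2.2)) = ∑ E ∈ trees Finset.univ, f E := by
    refine Finset.sum_bij (fun p _ => insert s(v, p.2.1) (p.2.2.1 ∪ p.2.2.2)) ?_ ?_ ?_ ?_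
    · intro p hp
      rw [Finset.mem_filter] at hp
      simp only [trees, Finset.mem_filter, Finset.mem_univ, true_and]
      exact good_tree hp.2
    · rintro ⟨B, i, E₁, E₂⟩ hp ⟨B', i', E₁', E₂'⟩ hp' heq
      rw [Finset.mem_filter] at hp hp'
      replace hp := hp.2
      replace hp' := hp'.2
      simp only at hp hp' heq
      have hB : B = B' := by rw [← good_cmp hp, heq, good_cmp hp']
      subst hB
      have h1 : E₁ = E₁' := by rw [← (good_filter hp).1, heq, (good_filter hp').1]
      have h2 : E₂ = E₂' := by rw [← (good_filter hp).2, heq, (good_filter hp').2]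
      subst h1 h2
      have hi : s(v, i) ∈ insert s(v, i') (E₁ ∪ E₂) := by rw [← heq]; simp
      have hi' : s(v, i) = s(v, i') := by
        rw [Finset.mem_insert] at hi
        exact hi.resolve_right (good_not_mem hp).1
      have : i = i' := by
        have h' : i = i' ∨ v = i' ∧ i = v := by simpa using hi'
        rcases h' with h' | h'
        · exact h'
        · exact h'.2.trans h'.1
      rw [this]
    · intro E hE
      simp only [trees, Finset.mem_filter, Finset.mem_univ, true_and] at hE
      obtain ⟨B, i, E₁, E₂, hg, he⟩ := tree_good huv hE
      exact ⟨(B, i, E₁, E₂), by simpa using hg, he⟩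
    · intros; rfl
  rw [← this]
  rw [Finset.sum_filter, Finset.sum_filter]
  simp only [Finset.sum_filter, trees, Fintype.sum_prod_type]
  refine Finset.sum_congr rfl fun B _ => ?_
  by_cases hB : u ∈ B ∧ v ∉ B
  · rw [if_pos hB]
    have h0 : ∀ g : V → ℝ, ∑ i ∈ B, g i = ∑ i, if i ∈ B then g i else 0 := by
      intro g; simp
    rw [h0]
    refine Finset.sum_congr rfl fun i _ => ?_
    by_cases hi : i ∈ B
    · rw [if_pos hi]
      refine Finset.sum_congr rfl fun E₁ _ => ?_
      by_cases h1 : TreeOn B E₁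
      · rw [if_pos h1]
        refine Finset.sum_congr rfl fun E₂ _ => ?_
        simp [Good, hB, hi, h1]
      · simp [Good, h1]
    · simp [Good, hi]
  · rw [if_neg hB]
    refine Finset.sum_eq_zero fun i _ => Finset.sum_eq_zero fun E₁ _ =>
      Finset.sum_eq_zero fun E₂ _ => if_neg ?_
    unfold Good
    tauto
end

def TW {V S : Type*} [Fintype V] [DecidableEq V] (K : Sym2 S → ℝ) (A : Finset V) (x : V → S) : ℝ :=
  ∑ E ∈ trees A, ∏ e ∈ E, K (e.map x)

lemma gE_map_reach {V W : Type*} (f : W ↪ V) (E : Finset (Sym2 W)) (a b : W) :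
    (gE (E.map f.sym2Map)).Reachable (f a) (f b) ↔ (gE E).Reachable a b := by
  have hmem : ∀ a b : W, s(f a, f b) ∈ E.map f.sym2Map ↔ s(a, b) ∈ E := by
    intro a b
    have : s(f a, f b) = f.sym2Map s(a, b) := by simp
    rw [this, Finset.mem_map']
  constructor
  · intro h
    have := reach_closed (P := fun y => ∃ w, y = f w ∧ (gE E).Reachable a w) ?_ h
      ⟨a, rfl, SimpleGraph.Reachable.refl _⟩
    · obtain ⟨w, hw, hr⟩ := this
      rw [f.injective hw]; exact hr
    · rintro _ y hxy ⟨w, rfl, hr⟩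
      rw [gE_adj] at hxy
      have hy : ∃ w', y = f w' := by
        obtain ⟨e, he, heq⟩ := Finset.mem_map.1 hxy.1
        have : y ∈ f.sym2Map e := by rw [heq]; simp
        rw [Function.Embedding.sym2Map_apply, Sym2.mem_map] at this
        obtain ⟨w', _, h⟩ := this
        exact ⟨w', h.symm⟩
      obtain ⟨w', rfl⟩ := hy
      refine ⟨w', rfl, hr.trans (SimpleGraph.Adj.reachable ?_)⟩
      rw [gE_adj]
      exact ⟨(hmem _ _).1 hxy.1, fun h => hxy.2 (by rw [h])⟩
  · intro h
    refine reach_closed (P := fun w => (gE (E.map f.sym2Map)).Reachable (f a) (f w)) ?_ h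
      (SimpleGraph.Reachable.refl _)
    intro x y hxy hr
    refine hr.trans (SimpleGraph.Adj.reachable ?_)
    rw [gE_adj] at *
    exact ⟨(hmem _ _).2 hxy.1, fun h => hxy.2 (f.injective h)⟩

lemma treeOn_map {V W : Type*} [Fintype W] (f : W ↪ V) (E : Finset (Sym2 W)) :
    TreeOn (Finset.univ.map f) (E.map f.sym2Map) ↔ TreeOn Finset.univ E := by
  unfold TreeOn
  refine and_congr ?_ (and_congr ?_ ?_)
  · constructor
    · intro h e he
      refine ⟨?_, fun a _ => Finset.mem_univ a⟩
      have := (h _ (Finset.mem_map_of_mem _ he)).1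
      intro hd
      apply this
      induction e using Sym2.ind with
      | _ a b => 
        simp only [Sym2.mk_isDiag_iff] at hd
        simp [hd]
    · intro h e he
      obtain ⟨e, he', rfl⟩ := Finset.mem_map.1 he
      have := h e he'
      induction e using Sym2.ind with
      | _ a b => simpa using this
  · constructor
    · intro h x _ y _
      exact (gE_map_reach f E x y).1 (h _ (by simp) _ (by simp))
    · intro h x hx y hy
      obtain ⟨x, _, rfl⟩ := Finset.mem_map.1 hx
      obtain ⟨y, _, rfl⟩ := Finset.mem_map.1 hy
      exact (gE_map_reach f E x y).2 (h _ (by simp) _ (by simp))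
  · simp

lemma TW_map {V W S : Type*} [Fintype V] [DecidableEq V] [Fintype W] [DecidableEq W]
    (K : Sym2 S → ℝ) (f : W ↪ V) (x : V → S) :
    TW K (Finset.univ.map f) x = TW K Finset.univ (x ∘ f) := by
  unfold TW
  symm
  refine Finset.sum_bij (fun E _ => E.map f.sym2Map) ?_ ?_ ?_ ?_
  · intro E hE
    simp only [trees, Finset.mem_filter, Finset.mem_univ, true_and] at *
    exact (treeOn_map f E).2 hE
  · intro E _ E' _ h
    exact Finset.map_injective _ h
  · intro E hE
    simp only [trees, Finset.mem_filter, Finset.mem_univ, true_and] at hE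
    have : ∃ E' : Finset (Sym2 W), E'.map f.sym2Map = E := by
      refine ⟨E.preimage f.sym2Map (f.sym2Map.injective.injOn), ?_⟩
      ext e
      simp only [Finset.mem_map, Finset.mem_preimage]
      constructor
      · rintro ⟨a, h, rfl⟩; exact h
      · intro he
        have h2 := (hE.1 e he).2
        induction e using Sym2.ind with
        | _ a b =>
          have ha := h2 a (by simp)
          have hb := h2 b (by simp)
          obtain ⟨a, _, rfl⟩ := Finset.mem_map.1 ha
          obtain ⟨b, _, rfl⟩ := Finset.mem_map.1 hb
          exact ⟨s(a, b), by simpa using he, by simp⟩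
    obtain ⟨E', rfl⟩ := this
    refine ⟨E', ?_, rfl⟩
    simp only [trees, Finset.mem_filter, Finset.mem_univ, true_and]
    exact (treeOn_map f E').1 hE
  · intro E _
    rw [Finset.prod_map]
    refine Finset.prod_congr rfl fun e _ => ?_
    rw [Function.Embedding.sym2Map_apply, Sym2.map_map]

lemma TW_equiv {V W S : Type*} [Fintype V] [DecidableEq V] [Fintype W] [DecidableEq W]
    (K : Sym2 S → ℝ) (f : W ≃ V) (x : V → S) :
    TW K Finset.univ (x ∘ f) = TW K Finset.univ x := by
  have := TW_map K f.toEmbedding x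
  simp only [Finset.map_univ_equiv] at this
  rw [this]; rfl

lemma treeWeight_eq {S : Type*} (κ : S → S → ℝ) (hsym : ∀ r s, κ r s = κ s r) (n : ℕ)
    (x : Fin n → S) :
    treeWeight n x κ = TW (Sym2.lift ⟨κ, hsym⟩) Finset.univ x := by
  unfold treeWeight TW
  have hmem : ∀ E ⊆ upperPairs n, ∀ a b, s(a, b) ∈ E.image (fun q => s(q.1, q.2)) ↔
      ((a, b) ∈ E ∨ (b, a) ∈ E) := by
    intro E hE a b
    simp only [Finset.mem_image, Prod.exists, Sym2.eq_iff]
    constructor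
    · rintro ⟨c, d, h, ⟨rfl, rfl⟩ | ⟨rfl, rfl⟩⟩ <;> simp [h]
    · rintro (h | h)
      · exact ⟨_, _, h, Or.inl ⟨rfl, rfl⟩⟩
      · exact ⟨_, _, h, Or.inr ⟨rfl, rfl⟩⟩
  have hinj : Set.InjOn (fun q : Fin n × Fin n => s(q.1, q.2)) (upperPairs n : Set _) := by
    rintro ⟨a, b⟩ h ⟨c, d⟩ h' heq
    simp only [upperPairs, Finset.coe_filter, Finset.mem_univ, true_and, Set.mem_ofPred_eq] at h h'
    simp only [Sym2.eq_iff] at heq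
    rcases heq with ⟨rfl, rfl⟩ | ⟨rfl, rfl⟩
    · rfl
    · exact absurd (h.trans h') (lt_irrefl _)
  have hgr : ∀ E ⊆ upperPairs n, graphOf E = gE (E.image (fun q => s(q.1, q.2))) := by
    intro E hE
    ext a b
    rw [gE_adj, hmem E hE, graphOf, SimpleGraph.fromRel_adj]
    tauto
  refine Finset.sum_bij (fun E _ => E.image (fun q => s(q.1, q.2))) ?_ ?_ ?_ ?_
  · intro E hE
    simp only [trees, Finset.mem_filter, Finset.mem_univ, true_and, Finset.mem_powerset] at *
    obtain ⟨hE, hc, hcard⟩ := hE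
    refine ⟨?_, ?_, ?_⟩
    · intro e he
      refine ⟨?_, fun a _ => Finset.mem_univ a⟩
      obtain ⟨q, hq, rfl⟩ := Finset.mem_image.1 he
      have := hE hq
      simp only [upperPairs, Finset.mem_filter, Finset.mem_univ, true_and] at this
      simpa using this.ne
    · intro a _ b _
      rw [← hgr E hE]
      exact hc.preconnected a b
    · rw [Finset.card_image_of_injOn (hinj.mono (by exact_mod_cast hE)), hcard]
      simp
  · intro E hE E' hE' h
    simp only [Finset.mem_filter, Finset.mem_powerset] at hE hE'
    ext q
    obtain ⟨a, b⟩ := q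
    have key : ∀ E ⊆ upperPairs n, ((a, b) ∈ E ↔ a < b ∧ s(a, b) ∈ E.image (fun q => s(q.1, q.2))) := by
      intro E hE
      rw [hmem E hE]
      have h1 : ∀ c d, (c, d) ∈ E → c < d := by
        intro c d h
        have := hE h
        simpa [upperPairs] using this
      constructor
      · intro h
        exact ⟨h1 _ _ h, Or.inl h⟩
      · rintro ⟨hab, h | h⟩
        · exact h
        · exact absurd (hab.trans (h1 _ _ h)) (lt_irrefl _)
    rw [key E hE.1, key E' hE'.1, h]
  · intro E hE
    simp only [trees, Finset.mem_filter, Finset.mem_univ, true_and] at hE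
    set F := (upperPairs n).filter (fun q => s(q.1, q.2) ∈ E) with hF
    have hFs : F ⊆ upperPairs n := Finset.filter_subset _ _
    have hFE : F.image (fun q => s(q.1, q.2)) = E := by
      ext e
      induction e using Sym2.ind with
      | _ a b =>
        rw [hmem F hFs]
        simp only [hF, upperPairs, Finset.mem_filter, Finset.mem_univ, true_and]
        constructor
        · rintro (h | h)
          · exact h.2
          · rw [Sym2.eq_swap]; exact h.2
        · intro h
          have := (hE.1 _ h).1
          simp only [Sym2.mk_isDiag_iff] at this
          rcases lt_or_gt_of_ne this with h' | h'
          · exact Or.inl ⟨h', h⟩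
          · exact Or.inr ⟨h', by rw [Sym2.eq_swap]; exact h⟩
    refine ⟨F, ?_, hFE⟩
    simp only [Finset.mem_filter, Finset.mem_powerset]
    have hcard : F.card + 1 = n := by
      have := hE.2.2
      rw [← hFE, Finset.card_image_of_injOn (hinj.mono (by exact_mod_cast hFs))] at this
      simpa using this
    refine ⟨hFs, ?_, hcard⟩
    have : Nonempty (Fin n) := ⟨⟨0, by omega⟩⟩
    refine SimpleGraph.Connected.mk fun a b => ?_
    rw [hgr F hFs, hFE]
    exact hE.2.1 a (by simp) b (by simp)
  · intro E hE
    simp only [Finset.mem_filter, Finset.mem_powerset] at hE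
    rw [Finset.prod_image (hinj.mono (by exact_mod_cast hE.1))]
    simp

section
variable {S : Type*} [Fintype S] [DecidableEq S]

def bb (K : Sym2 S → ℝ) (θ : S → ℝ) (W : Type) [Fintype W] [DecidableEq W] (w : W) (r : S) : ℝ :=
  ∑ x : W → S, if x w = r then TW K Finset.univ x * ∏ i, θ (x i) else 0

lemma bb_equiv (K : Sym2 S → ℝ) (θ : S → ℝ) {W V : Type} [Fintype W] [DecidableEq W]
    [Fintype V] [DecidableEq V] (f : W ≃ V) (w : W) (r : S) :
    bb K θ V (f w) r = bb K θ W w r := by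
  unfold bb
  refine Fintype.sum_equiv (Equiv.arrowCongr f.symm (Equiv.refl S)) _ _ fun x => ?_
  have h1 : (Equiv.arrowCongr f.symm (Equiv.refl S)) x = x ∘ f := by
    ext; simp
  rw [h1, TW_equiv]
  have h2 : ∏ i, θ ((x ∘ f) i) = ∏ i, θ (x i) := f.prod_comp (fun i => θ (x i))
  rw [h2]
  rfl

def bn (K : Sym2 S → ℝ) (θ : S → ℝ) (m : ℕ) (r : S) : ℝ := bb K θ (Fin (m + 1)) 0 r

lemma bb_eq_bn (K : Sym2 S → ℝ) (θ : S → ℝ) {W : Type} [Fintype W] [DecidableEq W] (w : W)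
    (m : ℕ) (h : Fintype.card W = m + 1) (r : S) : bb K θ W w r = bn K θ m r := by
  let f := Fintype.equivFinOfCardEq h
  let g := f.trans (Equiv.swap (f w) 0)
  have : g w = 0 := by simp [g]
  unfold bn
  rw [← this, bb_equiv]

lemma TW_eq_sub {V : Type*} [Fintype V] [DecidableEq V] (K : Sym2 S → ℝ) (x : V → S)
    (p : V → Prop) [DecidablePred p] :
    TW K (Finset.univ.filter p) x = TW K Finset.univ (fun a : {a // p a} => x a) := by
  have := TW_map K (Function.Embedding.subtype p) x
  have h : Finset.univ.map (Function.Embedding.subtype p) = Finset.univ.filter p := by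
    ext; simp
  rw [h] at this
  exact this

lemma fact_sum (K : Sym2 S → ℝ) (θ : S → ℝ) {V : Type} [Fintype V] [DecidableEq V]
    (B : Finset V) (v i : V) (hv : v ∉ B) (hi : i ∈ B) (r : S) (m n : ℕ)
    (hm : B.card = m + 1) (hn : Bᶜ.card = n + 1) :
    ∑ x : V → S, (if x v = r then K s(x v, x i) * (TW K B x * TW K Bᶜ x) * ∏ a, θ (x a) else 0)
      = (∑ s, K s(r, s) * bn K θ m s) * bn K θ n r := by
  have h1 : ∀ s, bb K θ {a // a ∈ B} ⟨i, hi⟩ s = bn K θ m s := fun s =>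
    bb_eq_bn K θ _ m (by simp [hm]) s
  have h2 : bb K θ {a // a ∉ B} ⟨v, hv⟩ r = bn K θ n r :=
    bb_eq_bn K θ _ n (by
      rw [Fintype.card_subtype, ← hn]; congr 1; ext; simp) r
  rw [← h2]
  simp_rw [← h1]
  have hL : ∑ s, K s(r, s) * bb K θ {a // a ∈ B} ⟨i, hi⟩ s =
      ∑ y : {a // a ∈ B} → S, K s(r, y ⟨i, hi⟩) * (TW K Finset.univ y * ∏ a, θ (y a)) := by
    unfold bb
    simp_rw [Finset.mul_sum]
    rw [Finset.sum_comm]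
    refine Finset.sum_congr rfl fun y _ => ?_
    rw [Finset.sum_eq_single (y ⟨i, hi⟩)]
    · simp
    · intro s _ hs
      rw [if_neg (Ne.symm hs), mul_zero]
    · simp
  rw [hL]
  unfold bb
  rw [Finset.sum_mul_sum, ← Fintype.sum_prod_type']
  refine Fintype.sum_equiv (Equiv.piEquivPiSubtypeProd (fun a => a ∈ B) (fun _ => S)) _ _ fun x => ?_
  simp only [Equiv.piEquivPiSubtypeProd_apply]
  by_cases hx : x v = r
  · rw [if_pos hx, if_pos hx]
    have e1 : B = Finset.univ.filter (· ∈ B) := by ext; simp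
    have e2 : Bᶜ = Finset.univ.filter (· ∉ B) := by ext; simp
    have t1 : TW K B x = TW K Finset.univ (fun a : {a // a ∈ B} => x a) := by
      conv_lhs => rw [e1]
      convert TW_eq_sub K x (· ∈ B)
    have t2 : TW K Bᶜ x = TW K Finset.univ (fun a : {a // a ∉ B} => x a) := by
      rw [e2]
      exact TW_eq_sub K x (· ∉ B)
    have t3 : ∏ a, θ (x a) = (∏ a : {a // a ∈ B}, θ (x a)) * ∏ a : {a // a ∉ B}, θ (x a) := by
      convert (Fintype.prod_subtype_mul_prod_subtype (fun a => a ∈ B) (fun a => θ (x a))).symm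
    rw [t1, t2, t3, hx]
    ring
  · rw [if_neg hx, if_neg hx, mul_zero]

lemma TW_rec (K : Sym2 S → ℝ) {V : Type} [Fintype V] [DecidableEq V] (u v : V) (huv : u ≠ v)
    (x : V → S) :
    TW K Finset.univ x = ∑ B ∈ Finset.univ.filter (fun B : Finset V => u ∈ B ∧ v ∉ B), ∑ i ∈ B,
      K s(x v, x i) * (TW K B x * TW K Bᶜ x) := by
  conv_lhs => unfold TW
  rw [sum_trees u v huv]
  refine Finset.sum_congr rfl fun B hB => Finset.sum_congr rfl fun i hi => ?_
  unfold TW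
  rw [Finset.sum_mul_sum, Finset.mul_sum]
  refine Finset.sum_congr rfl fun E₁ h1 => ?_
  rw [Finset.mul_sum]
  refine Finset.sum_congr rfl fun E₂ h2 => ?_
  simp only [trees, Finset.mem_filter, Finset.mem_univ, true_and] at hB h1 h2
  obtain ⟨hn, hd⟩ := good_not_mem (u := u) (v := v) ⟨hB.1, hB.2, hi, h1, h2⟩
  rw [Finset.prod_insert hn, Finset.prod_union hd]
  simp

lemma bn_rec (K : Sym2 S → ℝ) (θ : S → ℝ) (n : ℕ) (r : S) :
    bn K θ (n + 1) r = ∑ j ∈ Finset.range (n + 1), (n.choose j : ℝ) * ((j + 1 : ℝ) *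
      ((∑ s, K s(r, s) * bn K θ j s) * bn K θ (n - j) r)) := by
  set v : Fin (n + 1 + 1) := 0 with hv
  set u : Fin (n + 1 + 1) := 1 with hu
  have huv : u ≠ v := by simp [hu, hv]
  have h1 : bn K θ (n + 1) r = ∑ B ∈ Finset.univ.filter
      (fun B : Finset (Fin (n + 1 + 1)) => u ∈ B ∧ v ∉ B), (B.card : ℝ) *
        ((∑ s, K s(r, s) * bn K θ (B.card - 1) s) * bn K θ (n + 1 - B.card) r) := by
    unfold bn bb
    have : ∀ x : Fin (n + 1 + 1) → S, (if x 0 = r then TW K Finset.univ x * ∏ i, θ (x i) else 0) =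
        ∑ B ∈ Finset.univ.filter (fun B : Finset (Fin (n + 1 + 1)) => u ∈ B ∧ v ∉ B), ∑ i ∈ B,
          (if x v = r then K s(x v, x i) * (TW K B x * TW K Bᶜ x) * ∏ a, θ (x a) else 0) := by
      intro x
      split_ifs with h
      · rw [TW_rec K u v huv x]
        simp_rw [Finset.sum_mul]
      · simp
    simp_rw [this]
    rw [Finset.sum_comm]
    refine Finset.sum_congr rfl fun B hB => ?_
    rw [Finset.sum_comm]
    simp only [Finset.mem_filter, Finset.mem_univ, true_and] at hB
    have hc1 : 1 ≤ B.card := Finset.card_pos.2 ⟨u, hB.1⟩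
    have hc2 : 1 ≤ Bᶜ.card := Finset.card_pos.2 ⟨v, by simpa using hB.2⟩
    have hc3 := Finset.card_add_card_compl B
    rw [Fintype.card_fin] at hc3
    rw [← nsmul_eq_mul, ← Finset.sum_const]
    refine Finset.sum_congr rfl fun i hi => ?_
    exact fact_sum K θ B v i hB.2 hi r (B.card - 1) (n + 1 - B.card) (by omega) (by omega)
  rw [h1]
  have h2 : Finset.univ.filter (fun B : Finset (Fin (n + 1 + 1)) => u ∈ B ∧ v ∉ B) =
      (Finset.univ \ {u, v} : Finset (Fin (n + 1 + 1))).powerset.image (insert u) := by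
    ext B
    simp only [Finset.mem_filter, Finset.mem_univ, true_and, Finset.mem_image, Finset.mem_powerset]
    constructor
    · rintro ⟨hu, hv⟩
      refine ⟨B.erase u, ?_, Finset.insert_erase hu⟩
      intro a ha
      rw [Finset.mem_erase] at ha
      simp only [Finset.mem_sdiff, Finset.mem_univ, true_and, Finset.mem_insert,
        Finset.mem_singleton, not_or]
      exact ⟨ha.1, fun h => hv (h ▸ ha.2)⟩
    · rintro ⟨C, hC, rfl⟩
      refine ⟨Finset.mem_insert_self _ _, ?_⟩
      rw [Finset.mem_insert, not_or]
      refine ⟨huv.symm, fun h => ?_⟩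
      have := hC h
      simp at this
  have hun : ∀ C ∈ (Finset.univ \ {u, v} : Finset (Fin (n + 1 + 1))).powerset, u ∉ C := by
    intro C hC h
    have := (Finset.mem_powerset.1 hC) h
    simp at this
  rw [h2, Finset.sum_image]
  · have h3 : (Finset.univ \ {u, v} : Finset (Fin (n + 1 + 1))).card = n := by
      rw [Finset.card_sdiff_of_subset (Finset.subset_univ _), Finset.card_univ, Fintype.card_fin,
        Finset.card_pair huv]
      omega
    have h4 := Finset.sum_powerset_apply_card (x := (Finset.univ \ {u, v} : Finset (Fin (n + 1 + 1)))) (fun j : ℕ => ((j + 1 : ℝ) *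
      ((∑ s, K s(r, s) * bn K θ j s) * bn K θ (n - j) r)))
    rw [h3] at h4
    simp only [nsmul_eq_mul] at h4
    rw [← h4]
    refine Finset.sum_congr rfl fun C hC => ?_
    rw [Finset.card_insert_of_notMem (hun C hC)]
    have : n + 1 - (C.card + 1) = n - C.card := by omega
    rw [this]
    push_cast
    simp
  · intro C hC D hD h
    rw [← Finset.erase_insert (hun C hC), ← Finset.erase_insert (hun D hD)]
    rw [h]
end

/-! ### Part B: counting type vectors -/

section
variable {S : Type*} [Fintype S] [DecidableEq S]

def cnt {W : Type*} [Fintype W] (x : W → S) (s : S) : ℕ :=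
  (Finset.univ.filter (fun i => x i = s)).card

lemma cnt_compat (k : S → ℕ) : cnt (compatVec k) = k := by
  funext s
  have h1 : (Finset.univ.val.map (compatVec k)) = ∑ s : S, (k s) • ({s} : Multiset S) := by
    rw [Fin.univ_val_map]
    have : List.ofFn (compatVec k) = compatList k := by
      apply List.ext_get
      · simp [compatList_length]
      · intro i h1 h2
        simp [compatVec]
    rw [this, compatList, Multiset.coe_toList]
  have h2 : Multiset.count s (Finset.univ.val.map (compatVec k)) = cnt (compatVec k) s := by
    rw [Multiset.count_map, cnt, Finset.card_def, Finset.filter_val]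
    congr 2
    ext; exact eq_comm
  rw [← h2, h1, Multiset.count_sum']
  simp [Multiset.count_singleton]

lemma TW_cnt (K : Sym2 S → ℝ) {V W : Type*} [Fintype V] [DecidableEq V] [Fintype W] [DecidableEq W]
    (x : V → S) (y : W → S) (h : cnt x = cnt y) : TW K Finset.univ x = TW K Finset.univ y := by
  have e : ∀ s, Nonempty ({a // x a = s} ≃ {b // y b = s}) := by
    intro s
    rw [← Fintype.card_eq, Fintype.card_subtype, Fintype.card_subtype]
    exact congrFun h s
  let f := Equiv.ofFiberEquiv (fun s => (e s).some)
  have hf : y ∘ f = x := by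
    ext a
    exact Equiv.ofFiberEquiv_map _ a
  rw [← hf, TW_equiv]

lemma tau_eq (κ : S → S → ℝ) (hsym : ∀ r s, κ r s = κ s r) {V : Type*} [Fintype V] [DecidableEq V]
    (x : V → S) : TW (Sym2.lift ⟨κ, hsym⟩) Finset.univ x = tau κ (cnt x) := by
  unfold tau
  rw [treeWeight_eq κ hsym]
  exact TW_cnt _ _ _ (cnt_compat _).symm

lemma prod_cnt {R : Type*} [CommMonoid R] {W : Type*} [Fintype W] (x : W → S) (θ : S → R) :
    ∏ i, θ (x i) = ∏ s, θ s ^ cnt x s := by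
  rw [← Finset.prod_fiberwise (s := Finset.univ) (g := x)]
  refine Finset.prod_congr rfl fun s _ => ?_
  rw [cnt, ← Finset.prod_const]
  refine Finset.prod_congr rfl fun i hi => ?_
  rw [(Finset.mem_filter.1 hi).2]

lemma card_cnt (n : ℕ) (k : S → ℕ) (hk : ∑ s, k s = n) :
    (Finset.univ.filter (fun x : Fin n → S => cnt x = k)).card = Nat.multinomial Finset.univ k := by
  have h1 := Finset.sum_pow_eq_sum_piAntidiag (R := MvPolynomial S ℕ) Finset.univ
    (fun s => MvPolynomial.X s) n
  have h2 : (∑ s : S, (MvPolynomial.X s : MvPolynomial S ℕ)) ^ n =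
      ∑ x : Fin n → S, MvPolynomial.monomial (Finsupp.equivFunOnFinite.symm (cnt x)) 1 := by
    rw [Fintype.sum_pow]
    refine Finset.sum_congr rfl fun x _ => ?_
    rw [MvPolynomial.monomial_eq, Finsupp.prod_fintype _ _ (by simp)]
    simp only [map_one, one_mul, Finsupp.equivFunOnFinite_symm_apply_apply]
    exact prod_cnt x _
  have h3 := congrArg (MvPolynomial.coeff (Finsupp.equivFunOnFinite.symm k)) (h2.symm.trans h1)
  rw [MvPolynomial.coeff_sum, MvPolynomial.coeff_sum] at h3
  have h4 : ∀ j : S → ℕ, ((Nat.multinomial Finset.univ j : MvPolynomial S ℕ) *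
      ∏ s, (MvPolynomial.X s : MvPolynomial S ℕ) ^ j s) =
      MvPolynomial.monomial (Finsupp.equivFunOnFinite.symm j) (Nat.multinomial Finset.univ j) := by
    intro j
    rw [MvPolynomial.monomial_eq, Finsupp.prod_fintype _ _ (by simp)]
    simp
  simp_rw [h4, MvPolynomial.coeff_monomial] at h3
  simp only [EmbeddingLike.apply_eq_iff_eq] at h3
  rw [Finset.card_filter, h3, Finset.sum_eq_single k]
  · simp
  · intro b _ hb; simp [hb]
  · intro hk'; simp [hk] at hk'

lemma sum_cnt (n : ℕ) (g : (S → ℕ) → ℝ) :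
    ∑ x : Fin n → S, g (cnt x) =
      ∑ k ∈ Finset.piAntidiag Finset.univ n, (Nat.multinomial Finset.univ k : ℝ) * g k := by
  have hm : ∀ x ∈ (Finset.univ : Finset (Fin n → S)),
      cnt x ∈ Finset.piAntidiag Finset.univ n := by
    intro x _
    simp only [Finset.mem_piAntidiag, Finset.mem_univ, implies_true, and_true]
    have := Finset.card_eq_sum_card_fiberwise (f := x) (s := Finset.univ) (t := Finset.univ)
      (by simp)
    have h2 : Finset.univ.sum (cnt x) = ∑ b, (Finset.univ.filter (fun a => x a = b)).card := rfl
    rw [h2]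
    simpa using this.symm
  rw [← Finset.sum_fiberwise_of_maps_to hm]
  refine Finset.sum_congr rfl fun k hk => ?_
  have hk' : ∑ s, k s = n := by simpa using hk
  rw [← card_cnt n k hk', ← nsmul_eq_mul, ← Finset.sum_const]
  refine Finset.sum_congr rfl fun x hx => ?_
  rw [(Finset.mem_filter.1 hx).2]

lemma link (κ : S → S → ℝ) (hsym : ∀ r s, κ r s = κ s r) (θ : S → ℝ) (n : ℕ) (r : S) :
    ∑ k ∈ Finset.piAntidiag Finset.univ (n + 1),
      (tau κ k * ∏ s, θ s ^ (k s) / ((k s).factorial : ℝ)) * (k r : ℝ) =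
    bn (Sym2.lift ⟨κ, hsym⟩) θ n r / (n.factorial : ℝ) := by
  set K := Sym2.lift ⟨κ, hsym⟩ with hK
  have h1 : ((n + 1 : ℕ) : ℝ) * bn K θ n r =
      ∑ x : Fin (n + 1) → S, (cnt x r : ℝ) * (tau κ (cnt x) * ∏ s, θ s ^ cnt x s) := by
    have : ∀ i : Fin (n + 1), bb K θ (Fin (n + 1)) i r = bn K θ n r := fun i =>
      bb_eq_bn K θ i n (by simp) r
    have h2 : ((n + 1 : ℕ) : ℝ) * bn K θ n r = ∑ i : Fin (n + 1), bb K θ (Fin (n + 1)) i r := by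
      simp [this]
    rw [h2]
    unfold bb
    rw [Finset.sum_comm]
    refine Finset.sum_congr rfl fun x _ => ?_
    rw [hK, tau_eq κ hsym x, prod_cnt, ← Finset.sum_filter, Finset.sum_const, nsmul_eq_mul]
    rfl
  rw [sum_cnt (n + 1) (fun k => (k r : ℝ) * (tau κ k * ∏ s, θ s ^ k s))] at h1
  have hn : (n.factorial : ℝ) ≠ 0 := by exact_mod_cast n.factorial_ne_zero
  have hn1 : ((n + 1 : ℕ) : ℝ) ≠ 0 := by exact_mod_cast n.succ_ne_zero
  rw [eq_div_iff hn]
  apply mul_left_cancel₀ hn1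
  rw [h1, Finset.sum_mul, Finset.mul_sum]
  refine Finset.sum_congr rfl fun k hk => ?_
  have hk' : ∑ s, k s = n + 1 := by simpa using hk
  have hm := Nat.multinomial_spec Finset.univ k
  rw [hk', Nat.factorial_succ] at hm
  have hm' : (∏ s, ((k s).factorial : ℝ)) * (Nat.multinomial Finset.univ k : ℝ) =
      ((n + 1 : ℕ) : ℝ) * (n.factorial : ℝ) := by exact_mod_cast hm
  rw [Finset.prod_div_distrib]
  have hne : (∏ s, ((k s).factorial : ℝ)) ≠ 0 :=
    Finset.prod_ne_zero_iff.2 fun s _ => by exact_mod_cast (k s).factorial_ne_zero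
  field_simp
  linear_combination (-(tau κ k * (∏ s, θ s ^ k s) * (k r : ℝ))) * hm'
end

/-! ### Part C: analysis of the recursion -/

lemma cauchy_le (u v : ℕ → ℝ) (hu : ∀ i, 0 ≤ u i) (hv : ∀ i, 0 ≤ v i) (N : ℕ) :
    ∑ n ∈ Finset.range N, ∑ p ∈ Finset.HasAntidiagonal.antidiagonal n, u p.1 * v p.2 ≤
      (∑ i ∈ Finset.range N, u i) * ∑ i ∈ Finset.range N, v i := by
  rw [Finset.sum_mul_sum, ← Finset.sum_product', Finset.sum_sigma']
  have hinj : Set.InjOn (fun x : (_ : ℕ) × ℕ × ℕ => x.2)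
      ((Finset.range N).sigma fun n => Finset.HasAntidiagonal.antidiagonal n : Finset _) := by
    rintro ⟨n, p⟩ h ⟨m, q⟩ h' heq
    simp only [Finset.coe_sigma, Set.mem_sigma_iff, Finset.mem_coe, Finset.HasAntidiagonal.mem_antidiagonal] at h h'
    simp only at heq
    subst heq
    rw [← h.2, ← h'.2]
  rw [← Finset.sum_image (f := fun p : ℕ × ℕ => u p.1 * v p.2) hinj]
  refine Finset.sum_le_sum_of_subset_of_nonneg ?_ ?_
  · intro p hp
    obtain ⟨⟨n, q⟩, h, rfl⟩ := Finset.mem_image.1 hp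
    simp only [Finset.mem_sigma, Finset.mem_range, Finset.HasAntidiagonal.mem_antidiagonal] at h
    simp only [Finset.mem_product, Finset.mem_range]
    omega
  · intro p _ _
    exact mul_nonneg (hu _) (hv _)

lemma le_cauchy (u v : ℕ → ℝ) (hu : ∀ i, 0 ≤ u i) (hv : ∀ i, 0 ≤ v i) (N : ℕ) :
    (∑ i ∈ Finset.range N, u i) * ∑ i ∈ Finset.range N, v i ≤ 
    ∑ n ∈ Finset.range (2 * N), ∑ p ∈ Finset.HasAntidiagonal.antidiagonal n, u p.1 * v p.2 := by
  rw [Finset.sum_mul_sum, ← Finset.sum_product', Finset.sum_sigma']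
  have hinj : Set.InjOn (fun x : (_ : ℕ) × ℕ × ℕ => x.2)
      ((Finset.range (2 * N)).sigma fun n => Finset.HasAntidiagonal.antidiagonal n : Finset _) := by
    rintro ⟨n, p⟩ h ⟨m, q⟩ h' heq
    simp only [Finset.coe_sigma, Set.mem_sigma_iff, Finset.mem_coe, Finset.HasAntidiagonal.mem_antidiagonal] at h h'
    simp only at heq
    subst heq
    rw [← h.2, ← h'.2]
  rw [← Finset.sum_image (f := fun p : ℕ × ℕ => u p.1 * v p.2) hinj]
  refine Finset.sum_le_sum_of_subset_of_nonneg ?_ ?_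
  · intro p hp
    simp only [Finset.mem_product, Finset.mem_range] at hp
    refine Finset.mem_image.2 ⟨⟨p.1 + p.2, p⟩, ?_, rfl⟩
    exact Finset.mem_sigma.2 ⟨Finset.mem_range.2 (by simp only; omega),
      Finset.HasAntidiagonal.mem_antidiagonal.2 rfl⟩
  · intro p _ _
    exact mul_nonneg (hu _) (hv _)

lemma deriv_compare (f g f' g' : ℝ → ℝ) (hf : ∀ t, HasDerivAt f (f' t) t)
    (hg : ∀ t, HasDerivAt g (g' t) t) (h0 : f 0 ≤ g 0)
    (h : ∀ t, 0 ≤ t → t ≤ 1 → f' t ≤ g' t) (t : ℝ) (ht0 : 0 ≤ t) (ht1 : t ≤ 1) : f t ≤ g t := by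
  have hd : ∀ t, HasDerivAt (fun t => g t - f t) (g' t - f' t) t := fun t => (hg t).sub (hf t)
  have hm : MonotoneOn (fun t => g t - f t) (Set.Icc 0 1) := by
    apply monotoneOn_of_deriv_nonneg (convex_Icc 0 1)
    · exact fun t _ => (hd t).continuousAt.continuousWithinAt
    · exact fun t _ => (hd t).differentiableAt.differentiableWithinAt
    · intro t ht
      rw [interior_Icc] at ht
      rw [(hd t).deriv]
      linarith [h t ht.1.le ht.2.le]
  have := hm (⟨le_refl _, zero_le_one⟩ : (0 : ℝ) ∈ Set.Icc (0 : ℝ) 1) ⟨ht0, ht1⟩ ht0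
  simp only at this
  linarith

def eJ (J : ℕ) (y : ℝ) : ℝ := ∑ j ∈ Finset.range J, y ^ j / (j.factorial : ℝ)

lemma eJ_deriv (J : ℕ) (y : ℝ) : HasDerivAt (eJ (J + 1)) (eJ J y) y := by
  induction J with
  | zero =>
    have : eJ (0 + 1) = fun _ => 1 := by funext y; simp [eJ]
    rw [this]
    simpa [eJ] using hasDerivAt_const y (1 : ℝ)
  | succ J ih =>
    have h1 : eJ (J + 1 + 1) = fun y => eJ (J + 1) y + y ^ (J + 1) / ((J + 1).factorial : ℝ) := by
      funext y; simp only [eJ]; rw [Finset.sum_range_succ]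
    have h2 : eJ (J + 1) y = eJ J y + y ^ J / (J.factorial : ℝ) := by
      simp only [eJ]; rw [Finset.sum_range_succ]
    rw [h1, h2]
    refine ih.add ?_
    have := (hasDerivAt_pow (J + 1) y).div_const ((J + 1).factorial : ℝ)
    have heq : y ^ J / (J.factorial : ℝ) =
        ((J + 1 : ℕ) : ℝ) * y ^ (J + 1 - 1) / ((J + 1).factorial : ℝ) := by
      rw [Nat.factorial_succ]
      have : (J.factorial : ℝ) ≠ 0 := by exact_mod_cast J.factorial_ne_zero
      have : (J + 1 : ℝ) ≠ 0 := by positivity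
      push_cast
      field_simp
    rw [heq]
    exact this

lemma eJ_tendsto (y : ℝ) : Tendsto (fun J => eJ J y) atTop (nhds (Real.exp y)) := by
  have := NormedSpace.expSeries_div_hasSum_exp (𝔸 := ℝ) y
  rw [← Real.exp_eq_exp_ℝ] at this
  exact this.tendsto_sum_nat

section
variable {S : Type*} [Fintype S]

lemma sigma_bdd (κ : S → S → ℝ) (hκ0 : ∀ r s, 0 ≤ κ r s) (c : S → ℝ) (hc0 : ∀ r, 0 ≤ c r) :
    BddAbove { t : ℝ | ∃ f : S → ℝ, (∀ s, 0 ≤ f s) ∧ (∑ r : S, c r * f r ^ 2) ≤ 1 ∧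
    t = Real.sqrt (∑ r : S, c r * (∑ s : S, κ r s * f s * c s) ^ 2) } := by
  refine ⟨Real.sqrt (∑ r : S, c r * (∑ s : S, κ r s * (1 + c s)) ^ 2), ?_⟩
  rintro t ⟨f, hf, hf1, rfl⟩
  apply Real.sqrt_le_sqrt
  refine Finset.sum_le_sum fun r _ => mul_le_mul_of_nonneg_left ?_ (hc0 r)
  have hb : ∀ s, f s * c s ≤ 1 + c s := by
    intro s
    have h1 : c s * f s ^ 2 ≤ 1 :=
      (Finset.single_le_sum (f := fun r => c r * f r ^ 2)
        (fun r _ => mul_nonneg (hc0 r) (sq_nonneg _)) (Finset.mem_univ s)).trans hf1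
    nlinarith [hc0 s, hf s, mul_nonneg (hc0 s) (sq_nonneg (f s - 1)), mul_nonneg (hc0 s) (hf s)]
  apply pow_le_pow_left₀
  · exact Finset.sum_nonneg fun s _ => mul_nonneg (mul_nonneg (hκ0 _ _) (hf s)) (hc0 s)
  · refine Finset.sum_le_sum fun s _ => ?_
    rw [mul_assoc]
    exact mul_le_mul_of_nonneg_left (hb s) (hκ0 _ _)

lemma sigma_use (κ : S → S → ℝ) (hκ0 : ∀ r s, 0 ≤ κ r s) (c : S → ℝ) (hc0 : ∀ r, 0 ≤ c r)
    (hSig : sigmaOp κ c ≤ 1) (f : S → ℝ) (hf : ∀ s, 0 ≤ f s) :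
    ∑ r, c r * (∑ s, κ r s * f s * c s) ^ 2 ≤ ∑ r, c r * f r ^ 2 := by
  set Q := ∑ r, c r * f r ^ 2 with hQ
  have hQ0 : 0 ≤ Q := Finset.sum_nonneg fun r _ => mul_nonneg (hc0 r) (sq_nonneg _)
  rcases hQ0.eq_or_lt with h | h
  · have hz : ∀ r, f r * c r = 0 := by
      intro r
      have := (Finset.sum_eq_zero_iff_of_nonneg
        (fun r _ => mul_nonneg (hc0 r) (sq_nonneg (f r)))).1 h.symm r (Finset.mem_univ r)
      rcases mul_eq_zero.1 this with h | h
      · simp [h]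
      · simp [pow_eq_zero_iff two_ne_zero |>.1 h]
    rw [← h]
    simp [mul_assoc, hz]
  · have hs : 0 < Real.sqrt Q := Real.sqrt_pos.2 h
    have hs2 : Real.sqrt Q ^ 2 = Q := Real.sq_sqrt hQ0
    have hmem := le_csSup (sigma_bdd κ hκ0 c hc0) ⟨fun s => f s / Real.sqrt Q,
      fun s => div_nonneg (hf s) hs.le, by
        have : ∀ r, c r * (f r / Real.sqrt Q) ^ 2 = (c r * f r ^ 2) / Q := by
          intro r; rw [div_pow, hs2]; ring
        simp_rw [this]
        rw [← Finset.sum_div, ← hQ, div_self h.ne'], rfl⟩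
    have h1 := hmem.trans hSig
    replace h1 := (Real.sqrt_le_iff.1 h1).2
    rw [one_pow] at h1
    have h2 : ∀ r, c r * (∑ s, κ r s * (f s / Real.sqrt Q) * c s) ^ 2 =
        (c r * (∑ s, κ r s * f s * c s) ^ 2) / Q := by
      intro r
      have : ∑ s, κ r s * (f s / Real.sqrt Q) * c s = (∑ s, κ r s * f s * c s) / Real.sqrt Q := by
        rw [Finset.sum_div]
        refine Finset.sum_congr rfl fun s _ => by ring
      rw [this, div_pow, hs2]; ring
    simp_rw [h2] at h1
    rw [← Finset.sum_div, div_le_one h] at h1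
    exact h1

lemma fp_unique (κ : S → S → ℝ) (hκ0 : ∀ r s, 0 ≤ κ r s) (c : S → ℝ) (hc0 : ∀ r, 0 ≤ c r)
    (hSig : sigmaOp κ c ≤ 1) (g : S → ℝ) (hgc : ∀ r, g r ≤ c r)
    (hg : ∀ r, c r * Real.exp (-(∑ t, κ r t * c t)) * Real.exp (∑ t, κ r t * g t) ≤ g r) :
    ∀ r, g r = c r := by
  set x : S → ℝ := fun r => ∑ s, κ r s * (c s - g s) with hx
  have hx0 : ∀ r, 0 ≤ x r := fun r =>
    Finset.sum_nonneg fun s _ => mul_nonneg (hκ0 _ _) (sub_nonneg.2 (hgc s))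
  set f : S → ℝ := fun r => 1 - Real.exp (-x r) with hf
  have hf0 : ∀ r, 0 ≤ f r := fun r => by
    have : Real.exp (-x r) ≤ 1 := Real.exp_le_one_iff.2 (by linarith [hx0 r])
    simp only [hf]; linarith
  have hh : ∀ r, c r - g r ≤ f r * c r := by
    intro r
    have h1 := hg r
    rw [mul_assoc, ← Real.exp_add] at h1
    have h2 : -(∑ t, κ r t * c t) + ∑ t, κ r t * g t = -x r := by
      simp only [hx, mul_sub, Finset.sum_sub_distrib]; ring
    rw [h2] at h1
    simp only [hf]; linarith
  have hxf : ∀ r, x r ≤ ∑ s, κ r s * f s * c s := by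
    intro r
    refine Finset.sum_le_sum fun s _ => ?_
    rw [mul_assoc]
    exact mul_le_mul_of_nonneg_left (hh s) (hκ0 _ _)
  have h1 : ∑ r, c r * x r ^ 2 ≤ ∑ r, c r * f r ^ 2 := by
    refine le_trans (Finset.sum_le_sum fun r _ => ?_) (sigma_use κ hκ0 c hc0 hSig f hf0)
    exact mul_le_mul_of_nonneg_left (pow_le_pow_left₀ (hx0 r) (hxf r) 2) (hc0 r)
  have hfx : ∀ r, f r ≤ x r := fun r => by
    have := Real.add_one_le_exp (-x r)
    simp only [hf]; linarith
  have h2 : ∀ r ∈ Finset.univ, c r * f r ^ 2 ≤ c r * x r ^ 2 := fun r _ =>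
    mul_le_mul_of_nonneg_left (pow_le_pow_left₀ (hf0 r) (hfx r) 2) (hc0 r)
  have h3 := (Finset.sum_eq_sum_iff_of_le h2).1 (le_antisymm (Finset.sum_le_sum h2) h1)
  intro r
  have h4 := h3 r (Finset.mem_univ r)
  rcases (hc0 r).eq_or_lt with h | h
  · have := hh r
    rw [← h, mul_zero] at this
    have h5 := hgc r
    rw [← h] at h5 ⊢
    linarith
  · have h5 : f r ^ 2 = x r ^ 2 := mul_left_cancel₀ h.ne' h4
    have h6 : f r = x r := (pow_left_inj₀ (hf0 r) (hx0 r) two_ne_zero).1 h5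
    have h7 : x r = 0 := by
      by_contra hne
      have := Real.add_one_lt_exp (neg_ne_zero.2 hne)
      simp only [hf] at h6
      linarith
    have h8 := hh r
    rw [h6, h7, zero_mul] at h8
    linarith [hgc r]

end

section
variable {S : Type*} [Fintype S]

def qN (α : ℕ → S → ℝ) (N : ℕ) (r : S) (t : ℝ) : ℝ := ∑ n ∈ Finset.range N, α n r * t ^ n
def pNN (α : ℕ → S → ℝ) (N : ℕ) (r : S) (t : ℝ) : ℝ := ∑ n ∈ Finset.range N, α n r * t ^ (n + 1)
def dN (α : ℕ → S → ℝ) (N : ℕ) (r : S) (t : ℝ) : ℝ :=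
  ∑ n ∈ Finset.range N, ((n : ℝ) + 1) * α n r * t ^ n
def QN (α : ℕ → S → ℝ) (N : ℕ) (r : S) (t : ℝ) : ℝ :=
  ∑ n ∈ Finset.range N, ((n : ℝ) + 1) * α (n + 1) r * t ^ n

lemma qN_deriv (α : ℕ → S → ℝ) (N : ℕ) (r : S) (t : ℝ) :
    HasDerivAt (qN α (N + 1) r) (QN α N r t) t := by
  have h1 : qN α (N + 1) r = fun t => (∑ n ∈ Finset.range N, α (n + 1) r * t ^ (n + 1)) + α 0 r := by
    funext t
    rw [qN, Finset.sum_range_succ']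
    simp
  rw [h1]
  refine HasDerivAt.add_const _ ?_
  refine HasDerivAt.fun_sum fun n _ => ?_
  have := (hasDerivAt_pow (n + 1) t).const_mul (α (n + 1) r)
  have heq : ((n : ℝ) + 1) * α (n + 1) r * t ^ n = α (n + 1) r * (((n + 1 : ℕ) : ℝ) * t ^ (n + 1 - 1)) := by
    push_cast
    ring
  rw [heq]
  exact this

lemma pNN_deriv (α : ℕ → S → ℝ) (N : ℕ) (r : S) (t : ℝ) :
    HasDerivAt (pNN α N r) (dN α N r t) t := by
  refine HasDerivAt.fun_sum fun n _ => ?_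
  have := (hasDerivAt_pow (n + 1) t).const_mul (α n r)
  have heq : ((n : ℝ) + 1) * α n r * t ^ n = α n r * (((n + 1 : ℕ) : ℝ) * t ^ (n + 1 - 1)) := by
    push_cast
    ring
  rw [heq]
  exact this

lemma kp_deriv (κ : S → S → ℝ) (α : ℕ → S → ℝ) (N : ℕ) (r : S) (t : ℝ) :
    HasDerivAt (fun t => ∑ s, κ r s * pNN α N s t) (∑ s, κ r s * dN α N s t) t :=
  HasDerivAt.fun_sum fun s _ => (pNN_deriv α N s t).const_mul (κ r s)

structure Rec (κ : S → S → ℝ) (θ : S → ℝ) (α : ℕ → S → ℝ) : Prop where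
  k0 : ∀ r s, 0 ≤ κ r s
  a0 : ∀ n r, 0 ≤ α n r
  init : ∀ r, α 0 r = θ r
  step : ∀ (n : ℕ) (r : S), ((n : ℝ) + 1) * α (n + 1) r = ∑ p ∈ Finset.HasAntidiagonal.antidiagonal n,
    α p.1 r * ∑ s, κ r s * (((p.2 : ℝ) + 1) * α p.2 s)

variable {κ : S → S → ℝ} {θ : S → ℝ} {α : ℕ → S → ℝ}

lemma Rec.QN_eq (h : Rec κ θ α) (N : ℕ) (r : S) (t : ℝ) :
    QN α N r t = ∑ n ∈ Finset.range N, ∑ p ∈ Finset.HasAntidiagonal.antidiagonal n,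
      (α p.1 r * t ^ p.1) * (∑ s, κ r s * (((p.2 : ℝ) + 1) * α p.2 s * t ^ p.2)) := by
  refine Finset.sum_congr rfl fun n _ => ?_
  rw [h.step, Finset.sum_mul]
  refine Finset.sum_congr rfl fun p hp => ?_
  rw [← Finset.HasAntidiagonal.mem_antidiagonal.1 hp, pow_add, Finset.mul_sum, Finset.mul_sum,
    Finset.sum_mul]
  refine Finset.sum_congr rfl fun s _ => ?_
  ring

lemma kd_eq (κ : S → S → ℝ) (α : ℕ → S → ℝ) (N : ℕ) (r : S) (t : ℝ) :
    ∑ s, κ r s * dN α N s t =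
      ∑ n ∈ Finset.range N, ∑ s, κ r s * (((n : ℝ) + 1) * α n s * t ^ n) := by
  rw [Finset.sum_comm]
  refine Finset.sum_congr rfl fun s _ => ?_
  rw [dN, Finset.mul_sum]

lemma Rec.nn (h : Rec κ θ α) (r : S) {t : ℝ} (ht : 0 ≤ t) (n : ℕ) : 0 ≤ α n r * t ^ n :=
  mul_nonneg (h.a0 _ _) (pow_nonneg ht _)

lemma Rec.nn2 (h : Rec κ θ α) (r : S) {t : ℝ} (ht : 0 ≤ t) (n : ℕ) :
    0 ≤ ∑ s, κ r s * (((n : ℝ) + 1) * α n s * t ^ n) :=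
  Finset.sum_nonneg fun s _ => mul_nonneg (h.k0 _ _)
    (mul_nonneg (mul_nonneg (by positivity) (h.a0 _ _)) (pow_nonneg ht _))

lemma Rec.QN_le (h : Rec κ θ α) (N : ℕ) (r : S) {t : ℝ} (ht : 0 ≤ t) :
    QN α N r t ≤ qN α N r t * ∑ s, κ r s * dN α N s t := by
  rw [h.QN_eq, kd_eq]
  exact cauchy_le (fun n => α n r * t ^ n)
    (fun n => ∑ s, κ r s * (((n : ℝ) + 1) * α n s * t ^ n)) (h.nn r ht) (h.nn2 r ht) N

lemma Rec.le_QN (h : Rec κ θ α) (N : ℕ) (r : S) {t : ℝ} (ht : 0 ≤ t) :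
    qN α N r t * ∑ s, κ r s * dN α N s t ≤ QN α (2 * N) r t := by
  rw [h.QN_eq, kd_eq]
  exact le_cauchy (fun n => α n r * t ^ n)
    (fun n => ∑ s, κ r s * (((n : ℝ) + 1) * α n s * t ^ n)) (h.nn r ht) (h.nn2 r ht) N

lemma Rec.q0 (h : Rec κ θ α) (N : ℕ) (r : S) : qN α (N + 1) r 0 = θ r := by
  rw [qN, Finset.sum_range_succ', ← h.init]; simp

lemma p0 (α : ℕ → S → ℝ) (N : ℕ) (r : S) : pNN α N r 0 = 0 := by
  simp [pNN]

lemma Rec.kd0 (h : Rec κ θ α) (N : ℕ) (r : S) {t : ℝ} (ht : 0 ≤ t) :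
    0 ≤ ∑ s, κ r s * dN α N s t := by
  rw [kd_eq]; exact Finset.sum_nonneg fun n _ => h.nn2 r ht n

lemma Rec.th0 (h : Rec κ θ α) (r : S) : 0 ≤ θ r := by rw [← h.init]; exact h.a0 _ _

lemma Rec.upper (h : Rec κ θ α) (N : ℕ) : ∀ (r : S) (t : ℝ), 0 ≤ t → t ≤ 1 →
    qN α N r t ≤ θ r * Real.exp (∑ s, κ r s * pNN α N s t) ∧
    qN α (N + 1) r t ≤ θ r * Real.exp (∑ s, κ r s * pNN α N s t) := by
  induction N with
  | zero =>
    intro r t ht0 ht1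
    have := h.th0 r
    constructor
    · simpa [qN, pNN] using this
    · simp [qN, pNN, h.init]
  | succ N ih =>
    have h1 : ∀ (r : S) (t : ℝ), 0 ≤ t → t ≤ 1 →
      qN α (N + 1) r t ≤ θ r * Real.exp (∑ s, κ r s * pNN α (N + 1) s t) := by
      intro r t ht0 ht1
      refine (ih r t ht0 ht1).2.trans ?_
      refine mul_le_mul_of_nonneg_left (Real.exp_le_exp.2 ?_) (h.th0 r)
      refine Finset.sum_le_sum fun s _ => mul_le_mul_of_nonneg_left ?_ (h.k0 _ _)
      rw [pNN, pNN, Finset.sum_range_succ]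
      linarith [mul_nonneg (h.a0 N s) (pow_nonneg ht0 (N + 1))]
    intro r t ht0 ht1
    refine ⟨h1 r t ht0 ht1, ?_⟩
    refine deriv_compare (qN α (N + 1 + 1) r)
      (fun t => θ r * Real.exp (∑ s, κ r s * pNN α (N + 1) s t)) _ _
      (fun t => qN_deriv α (N + 1) r t)
      (fun t => ((kp_deriv κ α (N + 1) r t).exp.const_mul (θ r))) ?_ ?_ t ht0 ht1
    · rw [h.q0]; simp [p0]
    · intro t ht0 ht1
      refine (h.QN_le (N + 1) r ht0).trans ?_
      rw [← mul_assoc]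
      exact mul_le_mul_of_nonneg_right (h1 r t ht0 ht1) (h.kd0 _ _ ht0)

lemma pNN_one (α : ℕ → S → ℝ) (N : ℕ) (r : S) : pNN α N r 1 = ∑ n ∈ Finset.range N, α n r := by
  simp [pNN]

lemma qN_one (α : ℕ → S → ℝ) (N : ℕ) (r : S) : qN α N r 1 = ∑ n ∈ Finset.range N, α n r := by
  simp [qN]

lemma Rec.le_c (h : Rec κ θ α) (c : S → ℝ) (hc0 : ∀ r, 0 ≤ c r)
    (hθ : ∀ r, θ r = c r * Real.exp (-(∑ t, κ r t * c t))) (N : ℕ) :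
    ∀ r, ∑ n ∈ Finset.range N, α n r ≤ c r := by
  induction N with
  | zero => simpa using hc0
  | succ N ih =>
    intro r
    have h1 := (h.upper N r 1 zero_le_one le_rfl).2
    simp only [qN_one, pNN_one] at h1
    refine h1.trans ?_
    rw [hθ, mul_assoc, ← Real.exp_add]
    have : Real.exp (-(∑ t, κ r t * c t) + ∑ s, κ r s * ∑ n ∈ Finset.range N, α n s) ≤ 1 := by
      rw [Real.exp_le_one_iff]
      have : ∑ s, κ r s * ∑ n ∈ Finset.range N, α n s ≤ ∑ s, κ r s * c s :=
        Finset.sum_le_sum fun s _ => mul_le_mul_of_nonneg_left (ih s) (h.k0 _ _)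
      linarith
    exact mul_le_of_le_one_right (hc0 r) this

lemma Rec.lower (h : Rec κ θ α) (N : ℕ) (J : ℕ) : ∃ M, ∀ (r : S) (t : ℝ), 0 ≤ t → t ≤ 1 →
    θ r * eJ J (∑ s, κ r s * pNN α N s t) ≤ qN α M r t := by
  induction J with
  | zero => exact ⟨0, fun r t _ _ => by simp [eJ, qN]⟩
  | succ J ih =>
    obtain ⟨M, hM⟩ := ih
    set L := max M N with hL
    refine ⟨2 * L + 1, fun r t ht0 ht1 => ?_⟩
    refine deriv_compare (fun t => θ r * eJ (J + 1) (∑ s, κ r s * pNN α N s t))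
      (qN α (2 * L + 1) r) (fun t => θ r * (eJ J (∑ s, κ r s * pNN α N s t) *
        ∑ s, κ r s * dN α N s t)) _ 
      (fun t => ((eJ_deriv J _).comp t (kp_deriv κ α N r t)).const_mul (θ r))
      (fun t => qN_deriv α (2 * L) r t) ?_ ?_ t ht0 ht1
    · rw [h.q0]
      simp only [p0, mul_zero, Finset.sum_const_zero]
      rw [eJ, Finset.sum_range_succ']
      simp
    · intro t ht0 ht1
      refine le_trans ?_ (h.le_QN L r ht0)
      rw [← mul_assoc]
      have hq : qN α M r t ≤ qN α L r t :=
        Finset.sum_le_sum_of_subset_of_nonneg (Finset.range_mono (le_max_left _ _))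
          fun n _ _ => h.nn r ht0 n
      have hd : ∑ s, κ r s * dN α N s t ≤ ∑ s, κ r s * dN α L s t := by
        rw [kd_eq, kd_eq]
        exact Finset.sum_le_sum_of_subset_of_nonneg (Finset.range_mono (le_max_right _ _))
          fun n _ _ => h.nn2 r ht0 n
      refine mul_le_mul ((hM r t ht0 ht1).trans hq) hd (h.kd0 _ _ ht0) ?_
      exact Finset.sum_nonneg fun n _ => h.nn r ht0 n

lemma Rec.hasSum (h : Rec κ θ α) (c : S → ℝ) (hc0 : ∀ r, 0 ≤ c r)
    (hθ : ∀ r, θ r = c r * Real.exp (-(∑ t, κ r t * c t))) (hSig : sigmaOp κ c ≤ 1) (r : S) :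
    HasSum (fun n => α n r) (c r) := by
  have hs : ∀ r, Summable (fun n => α n r) := fun r =>
    summable_of_sum_range_le (fun n => h.a0 n r) (fun n => h.le_c c hc0 hθ n r)
  have hg : ∀ r, (∑' n, α n r) = c r := by
    refine fp_unique κ h.k0 c hc0 hSig (fun r => ∑' n, α n r) ?_ ?_
    · exact fun r => Real.tsum_le_of_sum_range_le (fun n => h.a0 n r) (fun n => h.le_c c hc0 hθ n r)
    · intro r
      rw [← hθ r]
      have h1 : ∀ N, θ r * Real.exp (∑ s, κ r s * ∑ n ∈ Finset.range N, α n s) ≤ ∑' n, α n r := by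
        intro N
        refine le_of_tendsto ((eJ_tendsto _).const_mul (θ r)) (Eventually.of_forall fun J => ?_)
        obtain ⟨M, hM⟩ := h.lower N J
        have := hM r 1 zero_le_one le_rfl
        simp only [pNN_one, qN_one] at this
        exact this.trans ((hs r).sum_le_tsum _ fun n _ => h.a0 n r)
      have h2 : Tendsto (fun N => θ r * Real.exp (∑ s, κ r s * ∑ n ∈ Finset.range N, α n s)) atTop
          (nhds (θ r * Real.exp (∑ s, κ r s * ∑' n, α n s))) := by
        refine Tendsto.const_mul _ ((Real.continuous_exp.tendsto _).comp ?_)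
        exact tendsto_finsetSum _ fun s _ => ((hs s).hasSum.tendsto_sum_nat).const_mul _
      exact le_of_tendsto h2 (Eventually.of_forall h1)
  rw [← hg r]
  exact (hs r).hasSum

/-- second identity -/
lemma Rec.sym_step (h : Rec κ θ α) (hsym : ∀ r s, κ r s = κ s r) (n : ℕ) :
    ((n : ℝ) + 1) * ∑ r, α (n + 1) r = ((n : ℝ) + 2) / 2 *
      ∑ p ∈ Finset.HasAntidiagonal.antidiagonal n, ∑ r, ∑ s, κ r s * (α p.1 r * α p.2 s) := by
  set B : ℕ × ℕ → ℝ := fun p => ∑ r, ∑ s, κ r s * (α p.1 r * α p.2 s) with hB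
  have hBs : ∀ p, B p.swap = B p := by
    intro p
    simp only [hB, Prod.fst_swap, Prod.snd_swap]
    rw [Finset.sum_comm]
    refine Finset.sum_congr rfl fun r _ => Finset.sum_congr rfl fun s _ => ?_
    rw [hsym]; ring
  have h1 : ((n : ℝ) + 1) * ∑ r, α (n + 1) r =
      ∑ p ∈ Finset.HasAntidiagonal.antidiagonal n, ((p.2 : ℝ) + 1) * B p := by
    rw [Finset.mul_sum]
    simp_rw [h.step]
    rw [Finset.sum_comm]
    refine Finset.sum_congr rfl fun p _ => ?_
    simp only [hB, Finset.mul_sum]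
    refine Finset.sum_congr rfl fun r _ => Finset.sum_congr rfl fun s _ => ?_
    ring
  have h2 : ∑ p ∈ Finset.HasAntidiagonal.antidiagonal n, ((p.2 : ℝ) + 1) * B p =
      ∑ p ∈ Finset.HasAntidiagonal.antidiagonal n, ((p.1 : ℝ) + 1) * B p := by
    rw [← Finset.sum_equiv (Equiv.prodComm ℕ ℕ) (s := Finset.HasAntidiagonal.antidiagonal n)
      (f := fun p => ((p.1 : ℝ) + 1) * B p)]
    · intro p; simp [add_comm]
    · intro p _
      simp only [Equiv.prodComm_apply, hBs, Prod.snd_swap]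
  have h3 : ∑ p ∈ Finset.HasAntidiagonal.antidiagonal n, ((p.1 : ℝ) + 1) * B p +
      ∑ p ∈ Finset.HasAntidiagonal.antidiagonal n, ((p.2 : ℝ) + 1) * B p =
      ((n : ℝ) + 2) * ∑ p ∈ Finset.HasAntidiagonal.antidiagonal n, B p := by
    rw [← Finset.sum_add_distrib, Finset.mul_sum]
    refine Finset.sum_congr rfl fun p hp => ?_
    rw [← Finset.HasAntidiagonal.mem_antidiagonal.1 hp]
    push_cast; ring
  linarith

lemma Rec.hasSum2 (h : Rec κ θ α) (hsym : ∀ r s, κ r s = κ s r) (c : S → ℝ)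
    (hs : ∀ r, HasSum (fun n => α n r) (c r)) :
    HasSum (fun n : ℕ => (n : ℝ) * ((∑ r, α n r) / ((n : ℝ) + 1)))
      (1 / 2 * ∑ r, ∑ s, c r * κ r s * c s) := by
  have h1 : ∀ r s, HasSum (fun n => ∑ p ∈ Finset.HasAntidiagonal.antidiagonal n, α p.1 r * α p.2 s)
      (c r * c s) := by
    intro r s
    have hn : ∀ r, Summable fun n => ‖α n r‖ := fun r => (hs r).summable.norm
    have := summable_norm_sum_mul_antidiagonal_of_summable_norm (hn r) (hn s)
    have h2 := tsum_mul_tsum_eq_tsum_sum_antidiagonal_of_summable_norm (hn r) (hn s)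
    rw [← (hs r).tsum_eq, ← (hs s).tsum_eq, h2]
    exact this.of_norm.hasSum
  have h2 : HasSum (fun n => 1 / 2 * ∑ r, ∑ s, κ r s *
      ∑ p ∈ Finset.HasAntidiagonal.antidiagonal n, α p.1 r * α p.2 s)
      (1 / 2 * ∑ r, ∑ s, κ r s * (c r * c s)) :=
    (hasSum_sum fun r _ => hasSum_sum fun s _ => (h1 r s).mul_left _).mul_left _
  have h3 : (1 / 2 * ∑ r, ∑ s, c r * κ r s * c s) = (1 / 2 * ∑ r, ∑ s, κ r s * (c r * c s)) := by
    congr 1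
    refine Finset.sum_congr rfl fun r _ => Finset.sum_congr rfl fun s _ => ?_
    ring
  rw [h3]
  rw [← hasSum_nat_add_iff' 1]
  simp only [Finset.range_one, Finset.sum_singleton, Nat.cast_zero, zero_mul, sub_zero]
  refine h2.congr_fun fun n => ?_
  have h4 := h.sym_step hsym n
  have h5 : ∑ p ∈ Finset.HasAntidiagonal.antidiagonal n, ∑ r, ∑ s, κ r s * (α p.1 r * α p.2 s) =
     ∑ r, ∑ s, κ r s * ∑ p ∈ Finset.HasAntidiagonal.antidiagonal n, α p.1 r * α p.2 s := by
    rw [Finset.sum_comm]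
    refine Finset.sum_congr rfl fun r _ => ?_
    rw [Finset.sum_comm]
    refine Finset.sum_congr rfl fun s _ => ?_
    rw [Finset.mul_sum]
  rw [h5] at h4
  push_cast
  have : (n : ℝ) + 1 + 1 ≠ 0 := by positivity
  rw [← mul_div_assoc, h4]
  field_simp
  ring

end

section
variable {S : Type*} [Fintype S] [DecidableEq S]

lemma hasSum_transfer (f : (S → ℕ) → ℝ) (hf : ∀ k, 0 ≤ f k) (h0 : f 0 = 0) (a : ℝ)
    (h : HasSum (fun n : ℕ => ∑ k ∈ Finset.piAntidiag Finset.univ (n + 1), f k) a) :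
    HasSum f a := by
  have hB : ∀ N : ℕ, ∑ n ∈ Finset.range N, ∑ k ∈ Finset.piAntidiag Finset.univ (n + 1), f k =
      ∑ k ∈ (Finset.range N).biUnion (fun n => Finset.piAntidiag (Finset.univ : Finset S) (n + 1)),
        f k := by
    intro N
    rw [Finset.sum_biUnion]
    intro n _ m _ hnm
    refine Finset.disjoint_left.2 fun k hk hk2 => hnm ?_
    have h1 : ∑ s, k s = n + 1 := by simpa using hk
    have h2 : ∑ s, k s = m + 1 := by simpa using hk2
    omega
  apply hasSum_of_isLUB_of_nonneg a hf
  constructor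
  · rintro _ ⟨T, rfl⟩
    have h1 : ∑ k ∈ T, f k ≤ ∑ n ∈ Finset.range (T.sup fun k => ∑ s, k s),
        ∑ k ∈ Finset.piAntidiag Finset.univ (n + 1), f k := by
      rw [hB]
      rw [← Finset.sum_erase T h0]
      refine Finset.sum_le_sum_of_subset_of_nonneg ?_ fun k _ _ => hf k
      intro k hk
      rw [Finset.mem_erase] at hk
      have h2 : ∑ s, k s ≤ T.sup fun k => ∑ s, k s :=
        Finset.le_sup (f := fun k : S → ℕ => ∑ s, k s) hk.2
      have h3 : ∑ s, k s ≠ 0 := by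
        intro h
        apply hk.1
        funext s
        exact (Finset.sum_eq_zero_iff.1 h) s (Finset.mem_univ s)
      refine Finset.mem_biUnion.2 ⟨∑ s, k s - 1, Finset.mem_range.2 (by omega), ?_⟩
      have h4 : ∑ s, k s = ∑ s, k s - 1 + 1 := by omega
      simp only [Finset.mem_piAntidiag, Finset.mem_univ, implies_true, and_true]
      exact h4
    exact h1.trans (sum_le_hasSum _ (fun n _ => Finset.sum_nonneg fun k _ => hf k) h)
  · intro b hb
    refine le_of_tendsto h.tendsto_sum_nat (Eventually.of_forall fun N => ?_)
    rw [hB]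
    exact hb ⟨_, rfl⟩

lemma tau_nonneg (κ : S → S → ℝ) (hκ0 : ∀ r s, 0 ≤ κ r s) (k : S → ℕ) : 0 ≤ tau κ k :=
  Finset.sum_nonneg fun _ _ => Finset.prod_nonneg fun _ _ => hκ0 _ _

lemma tau_zero (κ : S → S → ℝ) : tau κ 0 = 0 := by
  unfold tau treeWeight
  apply Finset.sum_eq_zero
  intro E hE
  have := (Finset.mem_filter.1 hE).2.2
  simp at this

lemma bn_zero (K : Sym2 S → ℝ) (θ : S → ℝ) (r : S) : bn K θ 0 r = θ r := by
  have h1 : ∀ x : Fin 1 → S, TW K Finset.univ x = 1 := by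
    intro x
    have : trees (Finset.univ : Finset (Fin 1)) = {∅} := by
      ext E
      simp only [trees, Finset.mem_filter, Finset.mem_univ, true_and, Finset.mem_singleton]
      constructor
      · rintro ⟨_, _, h⟩
        simpa using h
      · rintro rfl
        refine ⟨by simp, ?_, by simp⟩
        intro x _ y _
        rw [Subsingleton.elim x y]
    rw [TW, this]; simp
  unfold bn bb
  simp only [h1, one_mul]
  rw [Finset.sum_eq_single (fun _ => r)]
  · simp
  · intro x _ hx
    rw [if_neg]
    intro h
    apply hx
    funext i
    have hi : i = 0 := Fin.fin_one_eq_zero i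
    rw [hi, ← h]
  · simp

lemma rec_bn (κ : S → S → ℝ) (hsym : ∀ r s, κ r s = κ s r) (hκ0 : ∀ r s, 0 ≤ κ r s)
    (θ : S → ℝ) (hθ : ∀ r, 0 ≤ θ r) :
    Rec κ θ (fun n r => bn (Sym2.lift ⟨κ, hsym⟩) θ n r / (n.factorial : ℝ)) where
  k0 := hκ0
  a0 n r := by
    rw [← link]
    refine Finset.sum_nonneg fun k _ => mul_nonneg (mul_nonneg (tau_nonneg κ hκ0 k) ?_) (by positivity)
    exact Finset.prod_nonneg fun s _ => div_nonneg (pow_nonneg (hθ s) _) (by positivity)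
  init r := by rw [bn_zero]; simp
  step n r := by
    rw [← Finset.Nat.sum_antidiagonal_swap, Finset.Nat.sum_antidiagonal_eq_sum_range_succ_mk, bn_rec]
    rw [Finset.sum_div, Finset.mul_sum]
    refine Finset.sum_congr rfl fun j hj => ?_
    have hjn : j ≤ n := by simpa [Nat.lt_succ_iff] using hj
    simp only [Prod.swap_prod_mk, Prod.fst_swap, Prod.snd_swap, Sym2.lift_mk]
    have e1 : ∑ s, κ r s * (((j : ℝ) + 1) * (bn (Sym2.lift ⟨κ, hsym⟩) θ j s / (j.factorial : ℝ))) =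
        ((j : ℝ) + 1) / (j.factorial : ℝ) * ∑ s, κ r s * bn (Sym2.lift ⟨κ, hsym⟩) θ j s := by
      rw [Finset.mul_sum]
      refine Finset.sum_congr rfl fun s _ => by ring
    rw [e1]
    have e2 : (n.choose j : ℝ) * (j.factorial : ℝ) * ((n - j).factorial : ℝ) = n.factorial := by
      exact_mod_cast Nat.choose_mul_factorial_mul_factorial hjn
    rw [Nat.factorial_succ]
    push_cast
    have f1 : (n.factorial : ℝ) ≠ 0 := by exact_mod_cast n.factorial_ne_zero
    have f2 : (j.factorial : ℝ) ≠ 0 := by exact_mod_cast j.factorial_ne_zero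
    have f3 : ((n - j).factorial : ℝ) ≠ 0 := by exact_mod_cast (n - j).factorial_ne_zero
    have f4 : (n : ℝ) + 1 ≠ 0 := by positivity
    field_simp
    rw [← e2]
    ring

lemma lamC_nonneg (κ : S → S → ℝ) (hκ0 : ∀ r s, 0 ≤ κ r s) (c : S → ℝ) (hc0 : ∀ r, 0 ≤ c r)
    (k : S → ℕ) : 0 ≤ lamC κ c k := by
  refine mul_nonneg (tau_nonneg κ hκ0 k) ?_
  exact Finset.prod_nonneg fun s _ => div_nonneg
    (pow_nonneg (mul_nonneg (hc0 s) (Real.exp_pos _).le) _) (by positivity)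

lemma lamC_zero (κ : S → S → ℝ) (c : S → ℝ) : lamC κ c 0 = 0 := by
  simp [lamC, tau_zero]

lemma lamC_hasSum (κ : S → S → ℝ) (hsym : ∀ r s, κ r s = κ s r) (hκ0 : ∀ r s, 0 ≤ κ r s)
    (c : S → ℝ) (hc0 : ∀ r, 0 ≤ c r) (hSig : sigmaOp κ c ≤ 1) :
    (∀ r, HasSum (fun k : S → ℕ => lamC κ c k * (k r : ℝ)) (c r)) ∧
    HasSum (fun k : S → ℕ => lamC κ c k * (((∑ s : S, k s : ℕ) : ℝ) - 1))
      (1 / 2 * ∑ r, ∑ s, c r * κ r s * c s) := by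
  set θ : S → ℝ := fun s => c s * Real.exp (-(∑ t : S, κ s t * c t)) with hθ
  have hrec := rec_bn κ hsym hκ0 θ (fun s => mul_nonneg (hc0 s) (Real.exp_pos _).le)
  have h1 := hrec.hasSum c hc0 (fun r => rfl) hSig
  have h2 := hrec.hasSum2 hsym c h1
  have hl : ∀ n r, ∑ k ∈ Finset.piAntidiag Finset.univ (n + 1), lamC κ c k * (k r : ℝ) =
      bn (Sym2.lift ⟨κ, hsym⟩) θ n r / (n.factorial : ℝ) := fun n r => link κ hsym θ n r
  constructor
  · intro r
    apply hasSum_transfer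
    · exact fun k => mul_nonneg (lamC_nonneg κ hκ0 c hc0 k) (by positivity)
    · simp
    · simp_rw [hl]
      exact h1 r
  · apply hasSum_transfer
    · intro k
      rcases Nat.eq_zero_or_pos (∑ s, k s) with h | h
      · have : k = 0 := by
          funext s
          exact (Finset.sum_eq_zero_iff.1 h) s (Finset.mem_univ s)
        rw [this, lamC_zero]; simp
      · refine mul_nonneg (lamC_nonneg κ hκ0 c hc0 k) ?_
        have : (1 : ℝ) ≤ ((∑ s : S, k s : ℕ) : ℝ) := by exact_mod_cast h
        linarith
    · simp [lamC_zero]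
    · refine h2.congr_fun fun n => ?_
      simp_rw [← hl]
      rw [Finset.sum_comm]
      rw [Finset.sum_div, Finset.mul_sum]
      refine Finset.sum_congr rfl fun k hk => ?_
      have hk1 : ∑ s, k s = n + 1 := by simpa using hk
      rw [← Finset.mul_sum]
      have hk2 : ∑ s, (k s : ℝ) = (n : ℝ) + 1 := by exact_mod_cast hk1
      rw [hk1, hk2]
      have : (n : ℝ) + 1 ≠ 0 := by positivity
      push_cast
      field_simp
      ring

end

/-! ### Part D: entropy -/

lemma ereal_split {ι : Type*} (b : ι → ℝ) (B : ℝ) (hb : HasSum b B) (d : ι → ℝ≥0∞) :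
    ∑' k, ((b k : EReal) + (d k : EReal)) = (B : EReal) + ((∑' k, d k : ℝ≥0∞) : EReal) := by
  have h1 : HasSum (fun k => (b k : EReal)) (B : EReal) :=
    hb.map (⟨⟨Real.toEReal, EReal.coe_zero⟩, EReal.coe_add⟩ : ℝ →+ EReal) continuous_coe_real_ereal
  have h2 : HasSum (fun k => (d k : EReal)) ((∑' k, d k : ℝ≥0∞) : EReal) :=
    ENNReal.summable.hasSum.map
      (⟨⟨(↑), EReal.coe_ennreal_zero⟩, EReal.coe_ennreal_add⟩ : ℝ≥0∞ →+ EReal)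
      continuous_coe_ennreal_ereal
  apply HasSum.tsum_eq
  have h3 := EReal.continuousAt_add (p := ((B : EReal), ((∑' k, d k : ℝ≥0∞) : EReal)))
    (Or.inl (EReal.coe_ne_top B)) (Or.inl (EReal.coe_ne_bot B))
  have h4 := h3.tendsto.comp (Tendsto.prodMk_nhds h1 h2)
  refine Tendsto.congr (fun T => ?_) h4
  simp only [Function.comp]
  rw [← Finset.sum_add_distrib]

lemma ent_ineq (x y : ℝ) (hx : 0 < x) (hy : 0 < y) :
    0 ≤ x * Real.log (x / y) - x + y ∧ (x * Real.log (x / y) - x + y = 0 ↔ x = y) := by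
  have h0 : Real.log (x / y) = - Real.log (y / x) := by rw [← Real.log_inv, inv_div]
  have h1 : Real.log (y / x) ≤ y / x - 1 := Real.log_le_sub_one_of_pos (div_pos hy hx)
  have h2 : x * (y / x) = y := by field_simp
  constructor
  · rw [h0]; nlinarith
  · constructor
    · intro h
      by_contra hne
      have h3 : Real.log (y / x) < y / x - 1 := by
        apply Real.log_lt_sub_one_of_pos (div_pos hy hx)
        intro h
        exact hne ((div_eq_one_iff_eq hx.ne').1 h).symm
      rw [h0] at h
      nlinarith
    · rintro rfl
      rw [div_self hx.ne']; simp

lemma ent_k (x ρ y l : ℝ) (hx : 0 ≤ x) (hρ : 0 ≤ ρ) (hy : 0 ≤ y)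
    (h : x ≠ 0 → y = ρ * Real.exp l) :
    ∃ d : ℝ≥0∞, entTerm x ρ = ((x * l + x - y : ℝ) : EReal) + (d : EReal) ∧ (d = 0 ↔ x = y) := by
  by_cases hx0 : x = 0
  · refine ⟨ENNReal.ofReal y, ?_, ?_⟩
    · rw [entTerm, if_pos hx0, EReal.coe_ennreal_ofReal, max_eq_left hy, ← EReal.coe_add, hx0]
      simp
    · rw [ENNReal.ofReal_eq_zero, hx0]
      exact ⟨fun h => le_antisymm hy h, fun h => h.symm.le⟩
  · have hxp : 0 < x := lt_of_le_of_ne hx (Ne.symm hx0)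
    have hyl := h hx0
    rcases hρ.eq_or_lt with h0 | h0
    · refine ⟨⊤, ?_, ?_⟩
      · rw [entTerm, if_neg hx0, if_pos h0.symm.le, EReal.coe_ennreal_top, EReal.coe_add_top]
      · rw [← h0, zero_mul] at hyl
        rw [hyl]
        simp [hx0]
    · have hyp : 0 < y := by rw [hyl]; positivity
      have hlog : x * Real.log (x / ρ) - (x * l + x - y) = x * Real.log (x / y) - x + y := by
        have : Real.log (x / y) = Real.log (x / ρ) - l := by
          rw [hyl, ← div_div, Real.log_div (by positivity) (by positivity), Real.log_exp]
        rw [this]; ring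
      obtain ⟨e1, e2⟩ := ent_ineq x y hxp hyp
      refine ⟨ENNReal.ofReal (x * Real.log (x / y) - x + y), ?_, ?_⟩
      · rw [entTerm, if_neg hx0, if_neg (not_le.2 h0), EReal.coe_ennreal_ofReal, max_eq_left e1,
          ← EReal.coe_add, ← hlog]
        congr 1
        ring
      · rw [ENNReal.ofReal_eq_zero, ← e2]
        exact ⟨fun h => le_antisymm h e1, fun h => h.le⟩

section
variable {S : Type*} [Fintype S] [DecidableEq S]

lemma lamC_rho (κ : S → S → ℝ) (μ : S → ℝ) (hμ0 : ∀ r, 0 < μ r) (c : S → ℝ) (hc0 : ∀ r, 0 ≤ c r)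
    (k : S → ℕ) (hk : ∀ s, c s = 0 → k s = 0) :
    lamC κ c k = rhoMu κ μ k *
      Real.exp (∑ s, (k s : ℝ) * (Real.log (c s / μ s) - ∑ t, κ s t * c t)) := by
  rw [lamC, rhoMu, Real.exp_sum, mul_assoc, ← Finset.prod_mul_distrib]
  congr 1
  refine Finset.prod_congr rfl fun s _ => ?_
  rcases (hc0 s).eq_or_lt with h | h
  · rw [hk s h.symm]; simp
  · have hd : 0 < c s / μ s := div_pos h (hμ0 s)
    rw [Real.exp_nat_mul, sub_eq_add_neg, Real.exp_add, Real.exp_log hd, div_mul_eq_mul_div,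
      ← mul_pow]
    congr 2
    have := (hμ0 s).ne'
    field_simp

lemma rho_nonneg (κ : S → S → ℝ) (hκ0 : ∀ r s, 0 ≤ κ r s) (μ : S → ℝ) (hμ0 : ∀ r, 0 < μ r)
    (k : S → ℕ) : 0 ≤ rhoMu κ μ k :=
  mul_nonneg (tau_nonneg κ hκ0 k) (Finset.prod_nonneg fun s _ =>
    div_nonneg (pow_nonneg (hμ0 s).le _) (by positivity))

lemma lam_sums (c : S → ℝ) (lam : (S → ℕ) → ℝ) (h0 : ∀ k, 0 ≤ lam k) (hz : lam 0 = 0)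
    (hs : ∀ r, HasSum (fun k : S → ℕ => lam k * (k r : ℝ)) (c r)) :
    ∃ Λ, HasSum lam Λ ∧
      HasSum (fun k : S → ℕ => lam k * (((∑ s : S, k s : ℕ) : ℝ) - 1)) ((∑ s, c s) - Λ) := by
  have h1 : HasSum (fun k : S → ℕ => lam k * ((∑ s : S, k s : ℕ) : ℝ)) (∑ s, c s) := by
    refine (hasSum_sum (s := Finset.univ) fun r _ => hs r).congr_fun fun k => ?_
    rw [← Finset.mul_sum]; push_cast; rfl
  have h2 : Summable lam := by
    refine Summable.of_nonneg_of_le h0 (fun k => ?_) h1.summable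
    rcases Nat.eq_zero_or_pos (∑ s, k s) with h | h
    · have : k = 0 := by
        funext s
        exact (Finset.sum_eq_zero_iff.1 h) s (Finset.mem_univ s)
      rw [this, hz]; simp
    · have : (1 : ℝ) ≤ ((∑ s : S, k s : ℕ) : ℝ) := by exact_mod_cast h
      exact le_mul_of_one_le_right (h0 k) this
  refine ⟨_, h2.hasSum, (h1.sub h2.hasSum).congr_fun fun k => ?_⟩
  ring

lemma IMi_eq (κ : S → S → ℝ) (hsym : ∀ r s, κ r s = κ s r) (hκ0 : ∀ r s, 0 ≤ κ r s)
    (μ : S → ℝ) (hμ0 : ∀ r, 0 < μ r) (c : S → ℝ) (hc0 : ∀ r, 0 ≤ c r) (hSig : sigmaOp κ c ≤ 1)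
    (lam : (S → ℕ) → ℝ) (h0 : ∀ k, 0 ≤ lam k) (hz : lam 0 = 0)
    (hs : ∀ r, HasSum (fun k : S → ℕ => lam k * (k r : ℝ)) (c r)) :
    ∃ D : ℝ≥0∞, IMi κ μ lam = (((∑ r : S, c r * Real.log (c r / μ r))
            + (1/2) * ∑ r : S, ∑ s : S, c r * κ r s * (μ s - c s) : ℝ) : EReal) + (D : EReal) ∧
      (D = 0 ↔ lam = lamC κ c) := by
  obtain ⟨g1, g2⟩ := lamC_hasSum κ hsym hκ0 c hc0 hSig
  obtain ⟨Λ, a1, a2⟩ := lam_sums c lam h0 hz hs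
  obtain ⟨Λ', b1, b2⟩ := lam_sums c (lamC κ c) (lamC_nonneg κ hκ0 c hc0) (lamC_zero κ c) g1
  have hΛ := b2.unique g2
  set L : S → ℝ := fun s => Real.log (c s / μ s) - ∑ t, κ s t * c t with hL
  have hsupp : ∀ k, lam k ≠ 0 → ∀ s, c s = 0 → k s = 0 := by
    intro k hk s hcs
    have h1 := hs s
    rw [hcs, hasSum_zero_iff_of_nonneg (fun k => mul_nonneg (h0 k) (by positivity))] at h1
    have h2 := congrFun h1 k
    simp only [Pi.zero_apply, mul_eq_zero, hk, false_or] at h2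
    exact_mod_cast h2
  have hk := fun k => ent_k (lam k) (rhoMu κ μ k) (lamC κ c k) (∑ s, (k s : ℝ) * L s) (h0 k)
    (rho_nonneg κ hκ0 μ hμ0 k) (lamC_nonneg κ hκ0 c hc0 k)
    (fun h => lamC_rho κ μ hμ0 c hc0 k (hsupp k h))
  choose d hd1 hd2 using hk
  have hl : HasSum (fun k : S → ℕ => lam k * ∑ s, (k s : ℝ) * L s) (∑ s, c s * L s) := by
    refine (hasSum_sum (s := Finset.univ) fun r _ => (hs r).mul_right (L r)).congr_fun fun k => ?_
    rw [Finset.mul_sum]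
    exact Finset.sum_congr rfl fun s _ => by ring
  have hb := (hl.add a1).sub b1
  refine ⟨∑' k, d k, ?_, ?_⟩
  · unfold IMi
    simp_rw [hd1]
    rw [ereal_split _ _ hb, a2.tsum_eq]
    simp_rw [(hs _).tsum_eq]
    rw [add_assoc, ← EReal.coe_add, add_right_comm, ← EReal.coe_add]
    congr 2
    have e1 : ∑ s, c s * L s = ∑ r, c r * Real.log (c r / μ r) - ∑ r, ∑ s, c r * κ r s * c s := by
      rw [← Finset.sum_sub_distrib]
      refine Finset.sum_congr rfl fun r _ => ?_
      simp only [hL, mul_sub, Finset.mul_sum, mul_assoc]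
    have e2 : ∑ r : S, ∑ s : S, c r * κ r s * (μ s - c s) =
        ∑ r : S, ∑ s : S, c r * κ r s * μ s - ∑ r, ∑ s, c r * κ r s * c s := by
      simp only [mul_sub, Finset.sum_sub_distrib]
    rw [e1, e2]
    linarith
  · rw [ENNReal.tsum_eq_zero]
    constructor
    · intro h; funext k; exact (hd2 k).1 (h k)
    · intro h k; exact (hd2 k).2 (congrFun h k)

end

/-- minimization of `I_Mi` under the constraint `c(λ) = c`, subcritical case. -/
theorem IMi_minimizer_subcritical
    {S : Type*} [Fintype S] [DecidableEq S] [Nonempty S]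
    (κ : S → S → ℝ) (hκsym : ∀ r s, κ r s = κ s r) (hκ0 : ∀ r s, 0 ≤ κ r s)
    (μ : S → ℝ) (hμ0 : ∀ r, 0 < μ r) (hμ1 : (∑ r : S, μ r) = 1)
    (c : S → ℝ) (hc0 : ∀ r, 0 ≤ c r) (hcμ : ∀ r, c r ≤ μ r) (hSig : sigmaOp κ c ≤ 1) :
    (∀ k : S → ℕ, 0 ≤ lamC κ c k) ∧ lamC κ c 0 = 0 ∧
      (∀ r, HasSum (fun k : S → ℕ => lamC κ c k * (k r : ℝ)) (c r)) ∧
      IMi κ μ (lamC κ c)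
        = (((∑ r : S, c r * Real.log (c r / μ r))
            + (1/2) * ∑ r : S, ∑ s : S, c r * κ r s * (μ s - c s) : ℝ) : EReal) ∧
      ∀ lam : (S → ℕ) → ℝ, (∀ k, 0 ≤ lam k) → lam 0 = 0 →
        (∀ r, HasSum (fun k : S → ℕ => lam k * (k r : ℝ)) (c r)) →
        IMi κ μ (lamC κ c) ≤ IMi κ μ lam ∧
          (IMi κ μ lam = IMi κ μ (lamC κ c) → lam = lamC κ c) := by
  obtain ⟨g1, g2⟩ := lamC_hasSum κ hκsym hκ0 c hc0 hSig
  have hn := lamC_nonneg κ hκ0 c hc0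
  have hz := lamC_zero κ c
  obtain ⟨D, hD, hD0⟩ := IMi_eq κ hκsym hκ0 μ hμ0 c hc0 hSig (lamC κ c) hn hz g1
  rw [hD0.2 rfl, EReal.coe_ennreal_zero, add_zero] at hD
  refine ⟨hn, hz, g1, hD, ?_⟩
  intro lam h0 hl0 hs
  obtain ⟨E, hE, hE0⟩ := IMi_eq κ hκsym hκ0 μ hμ0 c hc0 hSig lam h0 hl0 hs
  rw [hD, hE]
  constructor
  · exact le_add_of_nonneg_right (EReal.coe_ennreal_nonneg E)
  · intro h
    apply hE0.1
    by_contra hne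
    have hpos : (0 : EReal) < (E : EReal) := by
      exact_mod_cast pos_iff_ne_zero.2 hne
    have hlt := EReal.add_lt_add_left_coe hpos ((∑ r : S, c r * Real.log (c r / μ r))
            + (1/2) * ∑ r : S, ∑ s : S, c r * κ r s * (μ s - c s))
    rw [add_zero, h] at hlt
    exact lt_irrefl _ hlt


end
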